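/- arXiv:2005.04371 — 3 statements merged into one kernel-verified Lean document; each statement's English description precedes it below -/
import Mathlib

section
/- There exist constants B > 0 and β > 0 such that for every n ≥ 0, all positive integers k_1 < k_2 < ⋯ < k_n < k_{n+1}, and all positive integers r_1, …, r_n, r, if the set E = {x ∈ (0,1) irrational : a_{k_1}(x) = r_1, …, a_{k_n}(x) = r_n} has positive Lebesgue measure, then | λ(E ∩ {x : a_{k_{n+1}}(x) = r}) / λ(E) − log(1 + 1/(r(r+2)))/log 2 | < B · exp(−β · √(k_{n+1} − k_n)). -/
open MeasureTheory Filter Real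

/-- The Gauss map `G(y) = 1/y - ⌊1/y⌋` (with `G 0 = 0`). -/
noncomputable def gaussMap (y : ℝ) : ℝ := Int.fract (1 / y)

/-- The `n`-th regular continued fraction digit `a_n(x) = ⌊1 / G^{n-1}(x)⌋`. -/
noncomputable def rcfDigit (x : ℝ) (n : ℕ) : ℕ := (⌊1 / gaussMap^[n - 1] x⌋).toNat

/-- The inverse branch of the Gauss map whose image is `{digit = j + 1}`. -/
noncomputable def gaussBranch (j : ℕ) (t : ℝ) : ℝ := 1 / (j + 1 + t)

theorem gaussBranch_pos (j : ℕ) {t : ℝ} (ht : 0 ≤ t) : 0 < gaussBranch j t := by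
  unfold gaussBranch; positivity

theorem gaussBranch_le_one (j : ℕ) {t : ℝ} (ht : 0 ≤ t) : gaussBranch j t ≤ 1 := by
  unfold gaussBranch
  rw [div_le_one (by positivity)]
  have : (0 : ℝ) ≤ j := j.cast_nonneg
  linarith

theorem one_div_gaussBranch (j : ℕ) (t : ℝ) : 1 / gaussBranch j t = j + 1 + t := by
  simp [gaussBranch]

theorem floor_add_one_add {t : ℝ} (ht : t ∈ Set.Ico (0 : ℝ) 1) (j : ℕ) :
    ⌊(j + 1 + t : ℝ)⌋ = j + 1 := by
  rw [Int.floor_eq_iff]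
  push_cast
  exact ⟨by linarith [ht.1], by linarith [ht.2]⟩

theorem gaussMap_gaussBranch (j : ℕ) {t : ℝ} (ht : t ∈ Set.Ico (0 : ℝ) 1) :
    gaussMap (gaussBranch j t) = t := by
  rw [gaussMap, one_div_gaussBranch, Int.fract, floor_add_one_add ht]
  push_cast
  ring

theorem rcfDigit_one_gaussBranch (j : ℕ) {t : ℝ} (ht : t ∈ Set.Ico (0 : ℝ) 1) :
    rcfDigit (gaussBranch j t) 1 = j + 1 := by
  simp only [rcfDigit, Nat.sub_self, Function.iterate_zero, id, one_div_gaussBranch,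
    floor_add_one_add ht]
  rfl

theorem rcfDigit_add (x : ℝ) (m d : ℕ) :
    rcfDigit x (m + (d + 1)) = rcfDigit (gaussMap^[m] x) (d + 1) := by
  simp only [rcfDigit, ← Function.iterate_add_apply]
  congr 4
  omega

theorem rcfDigit_gaussBranch (j n : ℕ) {t : ℝ} (ht : t ∈ Set.Ico (0 : ℝ) 1) :
    rcfDigit (gaussBranch j t) (n + 2) = rcfDigit t (n + 1) := by
  rw [show n + 2 = 1 + (n + 1) by ring, rcfDigit_add, Function.iterate_one,
    gaussMap_gaussBranch j ht]

theorem measurable_gaussMap : Measurable gaussMap := by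
  unfold gaussMap; fun_prop

theorem measurable_rcfDigit (n : ℕ) : Measurable fun x => rcfDigit x n := by
  unfold rcfDigit
  have h := measurable_gaussMap.iterate (n - 1)
  have h' : Measurable fun x => 1 / gaussMap^[n - 1] x := by fun_prop
  exact (measurable_of_countable Int.toNat).comp h'.floor

theorem measurable_gaussBranch (j : ℕ) : Measurable (gaussBranch j) := by
  unfold gaussBranch; fun_prop

theorem injOn_gaussBranch (j : ℕ) : Set.InjOn (gaussBranch j) (Set.Ico 0 1) :=
  fun t ht u hu h => by rw [← gaussMap_gaussBranch j ht, h, gaussMap_gaussBranch j hu]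

theorem iUnion_gaussBranch_image : ⋃ j, gaussBranch j '' Set.Ico 0 1 = Set.Ioc 0 1 := by
  ext x
  simp only [Set.mem_iUnion, Set.mem_image]
  constructor
  · rintro ⟨j, t, ht, rfl⟩
    exact ⟨gaussBranch_pos j ht.1, gaussBranch_le_one j ht.1⟩
  · rintro ⟨h0, h1⟩
    have h2 : 1 ≤ ⌊1 / x⌋₊ := by
      rw [Nat.one_le_floor_iff, le_div_iff₀ h0]; linarith
    refine ⟨⌊1 / x⌋₊ - 1, Int.fract (1 / x), ⟨Int.fract_nonneg _, Int.fract_lt_one _⟩, ?_⟩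
    have h3 : ((⌊1 / x⌋₊ : ℕ) : ℝ) = ((⌊1 / x⌋ : ℤ) : ℝ) :=
      natCast_floor_eq_intCast_floor (by positivity)
    rw [gaussBranch, Nat.cast_sub h2, h3, Nat.cast_one, sub_add_cancel, Int.floor_add_fract,
      one_div_one_div]

theorem pairwise_disjoint_gaussBranch_image :
    Pairwise (Function.onFun Disjoint fun j => gaussBranch j '' Set.Ico 0 1) := by
  intro i j hij
  rw [Function.onFun, Set.disjoint_left]
  rintro _ ⟨t, ht, rfl⟩ ⟨u, hu, h⟩
  apply hij
  have := rcfDigit_one_gaussBranch j hu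
  rw [h, rcfDigit_one_gaussBranch i ht] at this
  omega

/-- Change of variables along the inverse branches of the Gauss map. -/
theorem setLIntegral_Ioo_eq_tsum_gaussBranch (F : ℝ → ENNReal) :
    ∫⁻ x in Set.Ioo 0 1, F x =
      ∑' j : ℕ, ∫⁻ t in Set.Ioo 0 1,
        ENNReal.ofReal (1 / (j + 1 + t) ^ 2) * F (gaussBranch j t) := by
  have hder : ∀ (j : ℕ), ∀ t ∈ Set.Ico (0 : ℝ) 1,
      HasDerivWithinAt (gaussBranch j) (-1 / (j + 1 + t) ^ 2) (Set.Ico 0 1) t := by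
    intro j t ht
    have h0 : (j + 1 + t : ℝ) ≠ 0 := by have := ht.1; positivity
    have h := ((hasDerivAt_id t).const_add (j + 1 : ℝ)).fun_inv h0
    unfold gaussBranch
    simpa only [one_div, id] using h.hasDerivWithinAt
  rw [setLIntegral_congr Ioo_ae_eq_Ioc, ← iUnion_gaussBranch_image, lintegral_iUnion _
    pairwise_disjoint_gaussBranch_image]
  · congr 1 with j
    rw [lintegral_image_eq_lintegral_abs_deriv_mul measurableSet_Ico (hder j)
      (injOn_gaussBranch j), setLIntegral_congr Ioo_ae_eq_Ico]
    refine setLIntegral_congr_fun measurableSet_Ico fun t ht => ?_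
    simp only [abs_div, abs_neg, abs_one, abs_of_nonneg (sq_nonneg (j + 1 + t : ℝ))]
  · exact fun j => measurableSet_Ico.image_of_continuousOn_injOn
      (fun t ht => (hder j t ht).continuousWithinAt) (injOn_gaussBranch j)

theorem hasSum_sub_of_tendsto_zero {u : ℕ → ℝ} (hu : Antitone u)
    (h0 : Tendsto u atTop (nhds 0)) : HasSum (fun j => u j - u (j + 1)) (u 0) := by
  rw [hasSum_iff_tendsto_nat_of_nonneg fun j => sub_nonneg.2 (hu j.le_succ)]
  simp only [Finset.sum_range_sub']
  simpa using h0.const_sub (u 0)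

/-- Transition weight of the digit `j + 1` from the state `s` (the ratio of consecutive
convergent denominators). -/
noncomputable def cfWeight (s : ℝ) (j : ℕ) : ℝ := (1 + s) / ((j + 1 + s) * (j + 2 + s))

theorem cfWeight_nonneg {s : ℝ} (hs : 0 ≤ s) (j : ℕ) : 0 ≤ cfWeight s j := by
  unfold cfWeight; positivity

theorem hasSum_one_div_mul_succ {s : ℝ} (hs : 0 ≤ s) :
    HasSum (fun j : ℕ => 1 / ((j + 1 + s) * (j + 2 + s))) (1 / (1 + s)) := by
  have hanti : Antitone fun j : ℕ => 1 / (j + 1 + s) := by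
    intro i j hij
    have : (i : ℝ) ≤ j := by exact_mod_cast hij
    exact one_div_le_one_div_of_le (by positivity) (by linarith)
  have hlim : Tendsto (fun j : ℕ => 1 / (j + 1 + s)) atTop (nhds 0) := by
    simp only [one_div, add_assoc]
    exact (tendsto_natCast_atTop_atTop.atTop_add tendsto_const_nhds).inv_tendsto_atTop
  have h := hasSum_sub_of_tendsto_zero hanti hlim
  simp only [Nat.cast_zero, zero_add] at h
  convert h using 2 with j
  push_cast
  have : (j + 1 + s : ℝ) ≠ 0 := by positivity
  have : (j + 1 + 1 + s : ℝ) ≠ 0 := by positivity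
  have : (j + 2 + s : ℝ) ≠ 0 := by positivity
  field_simp
  ring

theorem hasSum_cfWeight {s : ℝ} (hs : 0 ≤ s) : HasSum (cfWeight s) 1 := by
  have h := (hasSum_one_div_mul_succ hs).mul_left (1 + s)
  rw [mul_one_div_cancel (by positivity)] at h
  have heq : cfWeight s = fun j : ℕ => (1 + s) * (1 / ((j + 1 + s) * (j + 2 + s))) := by
    funext j
    rw [cfWeight, mul_one_div]
  rwa [heq]

theorem gaussBranch_sub (j : ℕ) {s t : ℝ} (hs : 0 ≤ s) (ht : 0 ≤ t) :
    gaussBranch j s - gaussBranch j t = -((s - t) / ((j + 1 + s) * (j + 1 + t))) := by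
  have : (j + 1 + s : ℝ) ≠ 0 := by positivity
  have : (j + 1 + t : ℝ) ≠ 0 := by positivity
  unfold gaussBranch
  field_simp
  ring

theorem cfWeight_sub (j : ℕ) {s t : ℝ} (hs : 0 ≤ s) (ht : 0 ≤ t) :
    cfWeight s j - cfWeight t j = (s - t) *
      ((j * ((j + 1 + s) + (j + 1 + t) + 1) - (j + 1 + s) * (j + 1 + t)) /
        ((j + 1 + s) * (j + 1 + t) * ((j + 2 + s) * (j + 2 + t)))) := by
  have : (j + 1 + s : ℝ) ≠ 0 := by positivity
  have : (j + 1 + t : ℝ) ≠ 0 := by positivity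
  have : (j + 2 + s : ℝ) ≠ 0 := by positivity
  have : (j + 2 + t : ℝ) ≠ 0 := by positivity
  unfold cfWeight
  field_simp
  ring

theorem gaussBranch_zero_sub (j : ℕ) {t : ℝ} (ht : 0 ≤ t) :
    gaussBranch j t - gaussBranch 0 t = -(j / ((1 + t) * (j + 1 + t))) := by
  have : (j + 1 + t : ℝ) ≠ 0 := by positivity
  have : (1 + t : ℝ) ≠ 0 := by positivity
  unfold gaussBranch
  push_cast
  rw [zero_add]
  field_simp
  ring

theorem gaussBranch_mem_Icc (j : ℕ) {t : ℝ} (ht : 0 ≤ t) : gaussBranch j t ∈ Set.Icc (0 : ℝ) 1 :=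
  ⟨(gaussBranch_pos j ht).le, gaussBranch_le_one j ht⟩

theorem abs_cfWeight_sub_le (j : ℕ) (hj : 1 ≤ j) {s t : ℝ} (hs : s ∈ Set.Icc (0 : ℝ) 1)
    (ht : t ∈ Set.Icc (0 : ℝ) 1) :
    |cfWeight s j - cfWeight t j| ≤ |s - t| * (j / ((j + 1) * (j + 2) ^ 2)) := by
  obtain ⟨hs0, hs1⟩ := hs
  obtain ⟨ht0, ht1⟩ := ht
  have hj' : (1 : ℝ) ≤ j := by exact_mod_cast hj
  have hst : 0 ≤ s * t := mul_nonneg hs0 ht0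
  rw [cfWeight_sub j hs0 ht0, abs_mul, abs_div,
    abs_of_pos (a := (j + 1 + s : ℝ) * (j + 1 + t) * ((j + 2 + s) * (j + 2 + t))) (by positivity)]
  refine mul_le_mul_of_nonneg_left ?_ (abs_nonneg _)
  calc _ ≤ ((j + 1) * j : ℝ) / ((j + 1) * (j + 1) * ((j + 2) * (j + 2))) := by
        refine div_le_div₀ (by positivity) ?_ (by positivity) ?_
        · rw [abs_le]
          constructor
          · nlinarith [mul_nonneg (sub_nonneg.2 hs1) (sub_nonneg.2 ht1)]
          · nlinarith
        · gcongr ?_ * ?_ * (?_ * ?_) <;> linarith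
    _ = _ := by field_simp

/-- Majorant of the contribution of the digit `j + 1` to the variation of the weights. -/
theorem hasSum_weight_majorant :
    HasSum (fun j : ℕ => if j = 0 then (3 / 8 : ℝ) else 4 / ((2 * j + 5) * (2 * j + 7)))
      (37 / 56) := by
  set q : ℕ → ℝ := fun j => if j = 0 then 37 / 56 else 2 / (2 * j + 5) with hq
  have hanti : Antitone q := by
    refine antitone_nat_of_succ_le fun j => ?_
    simp only [hq]
    rcases Nat.eq_zero_or_pos j with rfl | hj
    · norm_num
    · rw [if_neg (by omega), if_neg (by omega)]
      push_cast
      exact div_le_div_of_nonneg_left (by norm_num) (by positivity) (by linarith)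
  have hlim : Tendsto q atTop (nhds 0) := by
    have h : Tendsto (fun j : ℕ => (2 : ℝ) / (2 * j + 5)) atTop (nhds 0) :=
      ((tendsto_natCast_atTop_atTop.const_mul_atTop two_pos).atTop_add
        tendsto_const_nhds).const_div_atTop 2
    refine h.congr' ?_
    filter_upwards [eventually_ne_atTop 0] with j hj
    simp [hq, hj]
  have h := hasSum_sub_of_tendsto_zero hanti hlim
  convert h using 1
  swap
  · simp [hq]
  funext j
  simp only [hq]
  rcases Nat.eq_zero_or_pos j with rfl | hj
  · norm_num
  · rw [if_neg (by omega), if_neg (by omega), if_neg (by omega)]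
    push_cast
    have : (2 * j + 5 : ℝ) ≠ 0 := by positivity
    have : (2 * (j + 1) + 5 : ℝ) ≠ 0 := by positivity
    have : (2 * j + 7 : ℝ) ≠ 0 := by positivity
    field_simp
    ring

/-- The transition operator `h ↦ ∑ j, cfWeight s j * h (1 / (j + 1 + s))` contracts Lipschitz
constants. -/
theorem abs_tsum_cfWeight_sub_le {h : ℝ → ℝ} {L : ℝ}
    (hL : ∀ x ∈ Set.Icc (0 : ℝ) 1, ∀ y ∈ Set.Icc (0 : ℝ) 1, |h x - h y| ≤ L * |x - y|)
    {s t : ℝ} (hs : s ∈ Set.Icc (0 : ℝ) 1) (ht : t ∈ Set.Icc (0 : ℝ) 1) :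
    |∑' j, cfWeight s j * h (gaussBranch j s) - ∑' j, cfWeight t j * h (gaussBranch j t)| ≤
      51 / 56 * L * |s - t| := by
  have hL0 : 0 ≤ L := by
    have := (abs_nonneg _).trans (hL 1 (by simp) 0 (by simp))
    simpa using this
  have hb : ∀ x ∈ Set.Icc (0 : ℝ) 1, |h x| ≤ |h 0| + L := fun x hx => by
    have h1 := hL x hx 0 (by simp)
    have h2 : |x - 0| ≤ 1 := by rw [sub_zero, abs_of_nonneg hx.1]; exact hx.2
    have h3 : |h x| ≤ |h 0| + |h x - h 0| := by
      simpa using abs_add_le (h 0) (h x - h 0)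
    nlinarith
  have hsum : ∀ u ∈ Set.Icc (0 : ℝ) 1, Summable fun j => cfWeight u j * h (gaussBranch j u) := by
    intro u hu
    refine Summable.of_norm_bounded ((hasSum_cfWeight hu.1).summable.mul_right (|h 0| + L))
      fun j => ?_
    rw [norm_mul, Real.norm_of_nonneg (cfWeight_nonneg hu.1 j)]
    exact mul_le_mul_of_nonneg_left (hb _ (gaussBranch_mem_Icc j hu.1)) (cfWeight_nonneg hu.1 j)
  have hdiff := (((hsum s hs).hasSum.sub (hsum t ht).hasSum).sub
    (((hasSum_cfWeight hs.1).sub (hasSum_cfWeight ht.1)).mul_right (h (gaussBranch 0 t))))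
  rw [sub_self, zero_mul, sub_zero] at hdiff
  have hmaj := (((hasSum_cfWeight hs.1).mul_right (1 / 4)).add hasSum_weight_majorant).mul_left
    (L * |s - t|)
  rw [← hdiff.tsum_eq, ← Real.norm_eq_abs]
  refine (tsum_of_norm_bounded hmaj fun j => ?_).trans_eq (by ring)
  rw [Real.norm_eq_abs]
  have hδ := abs_nonneg (s - t)
  have hfirst : |h (gaussBranch j s) - h (gaussBranch j t)| ≤
      L * |s - t| * (1 / ((j + 1 + s) * (j + 1 + t))) := by
    have hs0 := hs.1
    have ht0 := ht.1
    refine (hL _ (gaussBranch_mem_Icc j hs.1) _ (gaussBranch_mem_Icc j ht.1)).trans_eq ?_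
    rw [gaussBranch_sub j hs.1 ht.1, abs_neg, abs_div,
      abs_of_pos (a := (j + 1 + s : ℝ) * (j + 1 + t)) (by positivity)]
    ring
  have hsplit : cfWeight s j * h (gaussBranch j s) - cfWeight t j * h (gaussBranch j t) -
      (cfWeight s j - cfWeight t j) * h (gaussBranch 0 t) =
      cfWeight s j * (h (gaussBranch j s) - h (gaussBranch j t)) +
      (cfWeight s j - cfWeight t j) * (h (gaussBranch j t) - h (gaussBranch 0 t)) := by ring
  rw [hsplit]
  refine (abs_add_le _ _).trans ?_
  rw [abs_mul, abs_mul, abs_of_nonneg (cfWeight_nonneg hs.1 j)]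
  have hw := cfWeight_nonneg hs.1 j
  obtain ⟨hs0, hs1⟩ := hs
  obtain ⟨ht0, ht1⟩ := ht
  rcases Nat.eq_zero_or_pos j with rfl | hj
  · have hw2 : cfWeight s 0 ≤ 1 / 2 := by
      unfold cfWeight
      push_cast
      rw [div_le_div_iff₀ (by positivity) (by norm_num)]
      nlinarith
    have hone : 1 / (((0 : ℕ) + 1 + s) * ((0 : ℕ) + 1 + t)) ≤ (1 : ℝ) := by
      push_cast
      rw [div_le_one (by positivity)]
      nlinarith [mul_nonneg hs0 ht0]
    have h1 : |h (gaussBranch 0 s) - h (gaussBranch 0 t)| ≤ L * |s - t| :=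
      hfirst.trans (mul_le_of_le_one_right (by positivity) hone)
    rw [sub_self, abs_zero, mul_zero, add_zero, if_pos rfl]
    refine (mul_le_mul_of_nonneg_left h1 hw).trans ?_
    rw [mul_comm]
    exact mul_le_mul_of_nonneg_left (by linarith) (by positivity)
  · rw [if_neg (by omega)]
    have hj' : (1 : ℝ) ≤ j := by exact_mod_cast hj
    have hquarter : 1 / ((j + 1 + s) * (j + 1 + t)) ≤ (1 / 4 : ℝ) := by
      apply one_div_le_one_div_of_le (by norm_num)
      nlinarith
    have h1 := hfirst.trans (mul_le_mul_of_nonneg_left hquarter (by positivity))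
    have h2 : |h (gaussBranch j t) - h (gaussBranch 0 t)| ≤ L * (j / (j + 1)) := by
      refine (hL _ (gaussBranch_mem_Icc j ht0) _ (gaussBranch_mem_Icc 0 ht0)).trans ?_
      rw [gaussBranch_zero_sub j ht0, abs_neg, abs_of_nonneg (by positivity)]
      gcongr
      nlinarith
    have h3 := mul_le_mul (abs_cfWeight_sub_le j hj ⟨hs0, hs1⟩ ⟨ht0, ht1⟩) h2 (abs_nonneg _)
      (by positivity)
    have h4 : (j / ((j + 1) * (j + 2) ^ 2)) * (j / (j + 1)) ≤
        (4 / ((2 * j + 5) * (2 * j + 7)) : ℝ) := by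
      rw [div_mul_div_comm, div_le_div_iff₀ (by positivity) (by positivity)]
      nlinarith [sq_nonneg (j : ℝ)]
    have h5 := mul_le_mul_of_nonneg_left h4 (mul_nonneg hL0 hδ)
    have h6 := mul_le_mul_of_nonneg_left h1 hw
    calc _ ≤ _ := add_le_add h6 (h3.trans_eq (by ring) |>.trans h5)
      _ = _ := by ring

/-- The law of `G^m x` given a cylinder of rank `m` with ratio `s` of consecutive convergent
denominators; `s = 0` gives Lebesgue measure on `(0, 1)`. -/
noncomputable def cfMeasure (s : ℝ) : Measure ℝ :=
  (volume.restrict (Set.Ioo 0 1)).withDensity fun t => ENNReal.ofReal ((1 + s) / (1 + s * t) ^ 2)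

/-- The Gauss measure `dt / (1 + t)` on `(0, 1)`, without its normalization `1 / log 2`. -/
noncomputable def gaussMeasure : Measure ℝ :=
  (volume.restrict (Set.Ioo 0 1)).withDensity fun t => ENNReal.ofReal (1 / (1 + t))

theorem cfMeasure_apply (s : ℝ) {S : Set ℝ} (hS : MeasurableSet S) :
    cfMeasure s S = ∫⁻ t in Set.Ioo 0 1,
      ENNReal.ofReal ((1 + s) / (1 + s * t) ^ 2) * S.indicator 1 t := by
  rw [cfMeasure, withDensity_apply _ hS, ← lintegral_indicator hS]
  refine lintegral_congr fun t => ?_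
  by_cases h : t ∈ S <;> simp [h]

theorem gaussMeasure_apply {S : Set ℝ} (hS : MeasurableSet S) :
    gaussMeasure S = ∫⁻ t in Set.Ioo 0 1, ENNReal.ofReal (1 / (1 + t)) * S.indicator 1 t := by
  rw [gaussMeasure, withDensity_apply _ hS, ← lintegral_indicator hS]
  refine lintegral_congr fun t => ?_
  by_cases h : t ∈ S <;> simp [h]

theorem cfMeasure_zero : cfMeasure 0 = volume.restrict (Set.Ioo 0 1) := by
  simp [cfMeasure]

theorem cfMeasure_congr (s : ℝ) {S T : Set ℝ} (h : ∀ t ∈ Set.Ioo (0 : ℝ) 1, t ∈ S ↔ t ∈ T) :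
    cfMeasure s S = cfMeasure s T := by
  refine measure_congr ?_
  have h1 : ∀ᵐ t ∂(volume.restrict (Set.Ioo (0 : ℝ) 1)), t ∈ Set.Ioo (0 : ℝ) 1 :=
    ae_restrict_mem measurableSet_Ioo
  have h2 := (withDensity_absolutelyContinuous (volume.restrict (Set.Ioo (0 : ℝ) 1))
    fun t => ENNReal.ofReal ((1 + s) / (1 + s * t) ^ 2)).ae_le h1
  filter_upwards [h2] with t ht
  exact propext (h t ht)

theorem setLIntegral_Ioo_ofReal_deriv {F f : ℝ → ℝ}
    (hF : ∀ t ∈ Set.Icc (0 : ℝ) 1, HasDerivAt F (f t) t) (hf : ContinuousOn f (Set.Icc 0 1))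
    (h0 : ∀ t ∈ Set.Icc (0 : ℝ) 1, 0 ≤ f t) :
    ∫⁻ t in Set.Ioo 0 1, ENNReal.ofReal (f t) = ENNReal.ofReal (F 1 - F 0) := by
  have hint : IntegrableOn f (Set.Icc 0 1) := hf.integrableOn_Icc
  have huIcc : Set.uIcc (0 : ℝ) 1 = Set.Icc 0 1 := Set.uIcc_of_le zero_le_one
  rw [Measure.restrict_congr_set (Ioo_ae_eq_Ioc (μ := volume) (a := (0 : ℝ)) (b := 1)),
    ← ofReal_integral_eq_lintegral_ofReal (hint.mono_set Set.Ioc_subset_Icc_self),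
    ← intervalIntegral.integral_of_le zero_le_one,
    intervalIntegral.integral_eq_sub_of_hasDerivAt (f := F)]
  · rwa [huIcc]
  · exact (huIcc ▸ hf).intervalIntegrable
  · filter_upwards [ae_restrict_mem measurableSet_Ioc] with t ht
    exact h0 t (Set.Ioc_subset_Icc_self ht)

theorem cfMeasure_univ {s : ℝ} (hs : 0 ≤ s) : cfMeasure s Set.univ = 1 := by
  have hpos : ∀ t ∈ Set.Icc (0 : ℝ) 1, 0 < 1 + s * t := fun t ht => by
    have := mul_nonneg hs ht.1
    linarith
  rw [cfMeasure_apply s MeasurableSet.univ]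
  simp only [Set.indicator_univ, Pi.one_apply, mul_one]
  rw [setLIntegral_Ioo_ofReal_deriv (F := fun t => (1 + s) * t / (1 + s * t))]
  · have := hpos 1 (by simp)
    simp only [mul_one, mul_zero, zero_div, sub_zero] at this ⊢
    rw [div_self this.ne', ENNReal.ofReal_one]
  · intro t ht
    have h := (((hasDerivAt_id t).const_mul (1 + s))).fun_div
      (((hasDerivAt_id t).const_mul s).const_add 1) (hpos t ht).ne'
    refine h.congr_deriv ?_
    simp only [id, mul_one]
    ring
  · intro t ht
    have := (hpos t ht).ne'
    fun_prop (disch := positivity)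
  · intro t ht
    positivity

theorem isProbabilityMeasure_cfMeasure {s : ℝ} (hs : 0 ≤ s) : IsProbabilityMeasure (cfMeasure s) :=
  ⟨cfMeasure_univ hs⟩

theorem cfMeasure_eq_tsum {s : ℝ} (hs : 0 ≤ s) {S : Set ℝ} (hS : MeasurableSet S) :
    cfMeasure s S = ∑' j, ENNReal.ofReal (cfWeight s j) *
      cfMeasure (gaussBranch j s) (gaussBranch j ⁻¹' S) := by
  rw [cfMeasure_apply s hS, setLIntegral_Ioo_eq_tsum_gaussBranch]
  congr 1 with j
  rw [cfMeasure_apply _ (measurable_gaussBranch j hS), ← lintegral_const_mul']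
  swap
  · exact ENNReal.ofReal_ne_top
  refine setLIntegral_congr_fun measurableSet_Ioo fun t ht => ?_
  have ht0 := ht.1
  simp only [← mul_assoc]
  have hind : (gaussBranch j ⁻¹' S).indicator (1 : ℝ → ENNReal) t =
      S.indicator 1 (gaussBranch j t) := rfl
  rw [← ENNReal.ofReal_mul (by positivity), ← ENNReal.ofReal_mul (cfWeight_nonneg hs j), hind]
  congr 2
  have : (j + 1 + s : ℝ) ≠ 0 := by positivity
  have : (j + 2 + s : ℝ) ≠ 0 := by positivity
  have : (j + 1 + t : ℝ) ≠ 0 := by positivity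
  have : (j + 1 + t + s : ℝ) ≠ 0 := by positivity
  have : (j + 1 + s + t : ℝ) ≠ 0 := by positivity
  unfold cfWeight gaussBranch
  field_simp
  ring

theorem gaussMeasure_eq_tsum {S : Set ℝ} (hS : MeasurableSet S) :
    gaussMeasure S = ∑' j : ℕ, ∫⁻ t in Set.Ioo 0 1,
      ENNReal.ofReal (1 / ((j + 1 + t) * (j + 2 + t))) * S.indicator 1 (gaussBranch j t) := by
  rw [gaussMeasure_apply hS, setLIntegral_Ioo_eq_tsum_gaussBranch]
  congr 1 with j
  refine setLIntegral_congr_fun measurableSet_Ioo fun t ht => ?_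
  have ht0 := ht.1
  simp only [← mul_assoc]
  rw [← ENNReal.ofReal_mul (by positivity)]
  congr 2
  have : (j + 2 + t : ℝ) ≠ 0 := by positivity
  have : (j + 1 + t : ℝ) ≠ 0 := by positivity
  unfold gaussBranch
  field_simp
  ring

theorem gaussMeasure_preimage_gaussMap {S : Set ℝ} (hS : MeasurableSet S) :
    gaussMeasure (gaussMap ⁻¹' S) = gaussMeasure S := by
  rw [gaussMeasure_eq_tsum (measurable_gaussMap hS), gaussMeasure_apply hS,
    ← lintegral_tsum fun j => ?_]
  · refine setLIntegral_congr_fun measurableSet_Ioo fun t ht => ?_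
    have ht' : t ∈ Set.Ico (0 : ℝ) 1 := ⟨ht.1.le, ht.2⟩
    have hS' : ∀ j, (gaussMap ⁻¹' S).indicator (1 : ℝ → ENNReal) (gaussBranch j t) =
        S.indicator 1 t := fun j => by
      have hmem : gaussBranch j t ∈ gaussMap ⁻¹' S ↔ t ∈ S := by
        rw [Set.mem_preimage, gaussMap_gaussBranch j ht']
      by_cases h : t ∈ S
      · rw [Set.indicator_of_mem h, Set.indicator_of_mem (hmem.2 h), Pi.one_apply, Pi.one_apply]
      · rw [Set.indicator_of_notMem h, Set.indicator_of_notMem (mt hmem.1 h)]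
    have hsum := hasSum_one_div_mul_succ ht'.1
    simp only [hS']
    rw [ENNReal.tsum_mul_right, ← ENNReal.ofReal_tsum_of_nonneg _ hsum.summable, hsum.tsum_eq]
    intro j
    have := ht'.1
    positivity
  · have h1 : Measurable ((gaussMap ⁻¹' S).indicator (1 : ℝ → ENNReal)) :=
      measurable_one.indicator (measurable_gaussMap hS)
    have h2 := h1.comp (measurable_gaussBranch j)
    exact (Measurable.mul (by fun_prop) h2).aemeasurable

theorem gaussMeasure_preimage_iterate {S : Set ℝ} (hS : MeasurableSet S) (n : ℕ) :
    gaussMeasure (gaussMap^[n] ⁻¹' S) = gaussMeasure S := by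
  induction n with
  | zero => rfl
  | succ n ih =>
    rw [Function.iterate_succ, Set.preimage_comp,
      gaussMeasure_preimage_gaussMap (measurable_gaussMap.iterate n hS), ih]

/-- The Gauss measure is a mixture of the measures `cfMeasure s`. -/
theorem gaussMeasure_eq_lintegral_cfMeasure {S : Set ℝ} (hS : MeasurableSet S) :
    gaussMeasure S = ∫⁻ s in Set.Ioo 0 1, ENNReal.ofReal (1 / (1 + s)) * cfMeasure s S := by
  have hind : Measurable (S.indicator (1 : ℝ → ENNReal)) := measurable_one.indicator hS
  have hswap : ∀ s ∈ Set.Ioo (0 : ℝ) 1, ENNReal.ofReal (1 / (1 + s)) * cfMeasure s S =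
      ∫⁻ t in Set.Ioo 0 1, ENNReal.ofReal (1 / (1 + s * t) ^ 2) * S.indicator 1 t := by
    intro s hs
    have hs0 := hs.1
    rw [cfMeasure_apply s hS, ← lintegral_const_mul' _ _ ENNReal.ofReal_ne_top]
    refine lintegral_congr fun t => ?_
    rw [← mul_assoc, ← ENNReal.ofReal_mul (by positivity)]
    congr 2
    field_simp
  rw [setLIntegral_congr_fun measurableSet_Ioo hswap, lintegral_lintegral_swap,
    gaussMeasure_apply hS]
  · refine setLIntegral_congr_fun measurableSet_Ioo fun t ht => ?_
    have ht0 := ht.1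
    rw [lintegral_mul_const _ (by fun_prop)]
    congr 1
    have hpos : ∀ s ∈ Set.Icc (0 : ℝ) 1, 0 < 1 + s * t := fun s hs => by
      have := mul_nonneg hs.1 ht0.le
      linarith
    rw [setLIntegral_Ioo_ofReal_deriv (F := fun s => s / (1 + s * t))]
    · simp
    · intro s hs
      have h := (hasDerivAt_id s).fun_div (((hasDerivAt_id s).mul_const t).const_add 1)
        (hpos s hs).ne'
      refine h.congr_deriv ?_
      simp only [id]
      ring
    · refine ContinuousOn.div (by fun_prop) (by fun_prop) fun s hs => ?_
      have := hpos s hs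
      positivity
    · intro s hs
      positivity
  · exact Measurable.aemeasurable (Measurable.mul (by fun_prop) (hind.comp measurable_snd))

theorem gaussMeasure_univ : gaussMeasure Set.univ = ENNReal.ofReal (Real.log 2) := by
  rw [gaussMeasure_apply MeasurableSet.univ]
  simp only [Set.indicator_univ, Pi.one_apply, mul_one]
  have hpos : ∀ t ∈ Set.Icc (0 : ℝ) 1, 0 < 1 + t := fun t ht => by linarith [ht.1]
  rw [setLIntegral_Ioo_ofReal_deriv (F := fun t => Real.log (1 + t))]
  · norm_num
  · exact fun t ht => ((hasDerivAt_id t).const_add 1).log (hpos t ht).ne'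
  · exact ContinuousOn.div (by fun_prop) (by fun_prop) fun t ht => (hpos t ht).ne'
  · exact fun t ht => (one_div_pos.2 (hpos t ht)).le

theorem measurableSet_rcfDigit_eq (n r : ℕ) : MeasurableSet {x | rcfDigit x n = r} :=
  measurable_rcfDigit n (measurableSet_singleton r)

theorem gaussMeasure_rcfDigit_one_eq {r : ℕ} (hr : 0 < r) :
    gaussMeasure {x | rcfDigit x 1 = r} =
      ENNReal.ofReal (Real.log (1 + 1 / ((r : ℝ) * ((r : ℝ) + 2)))) := by
  obtain ⟨i, rfl⟩ : ∃ i, r = i + 1 := ⟨r - 1, by omega⟩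
  rw [gaussMeasure_eq_tsum (measurableSet_rcfDigit_eq _ _), tsum_eq_single i]
  · have h1 : ∀ t ∈ Set.Ioo (0 : ℝ) 1, ENNReal.ofReal (1 / ((i + 1 + t) * (i + 2 + t))) *
        {x | rcfDigit x 1 = i + 1}.indicator 1 (gaussBranch i t) =
        ENNReal.ofReal (1 / ((i + 1 + t) * (i + 2 + t))) := fun t ht => by
      simp [rcfDigit_one_gaussBranch i ⟨ht.1.le, ht.2⟩]
    rw [setLIntegral_congr_fun measurableSet_Ioo h1,
      setLIntegral_Ioo_ofReal_deriv (F := fun t => Real.log (i + 1 + t) - Real.log (i + 2 + t))]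
    · congr 1
      push_cast
      have e : (1 + 1 / ((i + 1) * (i + 1 + 2)) : ℝ) =
          ((i + 1 + 1) / (i + 2 + 1)) / ((i + 1 + 0) / (i + 2 + 0)) := by
        field_simp
        ring
      rw [e, Real.log_div (by positivity) (by positivity),
        Real.log_div (by positivity) (by positivity), Real.log_div (by positivity) (by positivity)]
    · intro t ht
      have ht0 := ht.1
      have h1 : (i + 1 + t : ℝ) ≠ 0 := by positivity
      have h2 : (i + 2 + t : ℝ) ≠ 0 := by positivity
      refine ((((hasDerivAt_id t).const_add _).log h1).fun_sub
        (((hasDerivAt_id t).const_add _).log h2)).congr_deriv ?_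
      simp only [id]
      field_simp
      ring
    · refine ContinuousOn.div (by fun_prop) (by fun_prop) fun t ht => ?_
      have := ht.1
      positivity
    · intro t ht
      have := ht.1
      positivity
  · intro j hj
    rw [setLIntegral_congr_fun (g := fun _ => 0) measurableSet_Ioo, lintegral_zero]
    intro t ht
    simp [rcfDigit_one_gaussBranch j ⟨ht.1.le, ht.2⟩, hj]

/-- The set of points whose first `m` digits satisfy the constraints `c`. -/
def digitCylinder (c : ℕ → Set ℕ) (m : ℕ) : Set ℝ := {x | ∀ i < m, rcfDigit x (i + 1) ∈ c i}

theorem measurableSet_digitCylinder (c : ℕ → Set ℕ) (m : ℕ) :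
    MeasurableSet (digitCylinder c m) := by
  have : digitCylinder c m = ⋂ i, ⋂ (_ : i < m), (fun x => rcfDigit x (i + 1)) ⁻¹' c i := by
    ext x
    simp [digitCylinder]
  rw [this]
  exact MeasurableSet.iInter fun i => MeasurableSet.iInter fun _ =>
    measurable_rcfDigit (i + 1) (Set.to_countable (c i)).measurableSet

theorem gaussBranch_mem_digitCylinder_succ (c : ℕ → Set ℕ) (m j : ℕ) {t : ℝ}
    (ht : t ∈ Set.Ico (0 : ℝ) 1) :
    gaussBranch j t ∈ digitCylinder c (m + 1) ↔
      j + 1 ∈ c 0 ∧ t ∈ digitCylinder (fun i => c (i + 1)) m := by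
  simp only [digitCylinder, Set.mem_ofPred_eq]
  rw [Nat.forall_lt_succ_left]
  simp only [zero_add, rcfDigit_one_gaussBranch j ht, add_assoc, Nat.reduceAdd,
    rcfDigit_gaussBranch j _ ht]

theorem cfMeasure_cylinder_inter_preimage (c : ℕ → Set ℕ) (m j : ℕ) (s : ℝ) (B : Set ℝ) :
    cfMeasure s (gaussBranch j ⁻¹' (digitCylinder c (m + 1) ∩ gaussMap^[m + 1] ⁻¹' B)) =
      {d | d + 1 ∈ c 0}.indicator (fun _ => cfMeasure s
        (digitCylinder (fun i => c (i + 1)) m ∩ gaussMap^[m] ⁻¹' B)) j := by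
  by_cases hj : j + 1 ∈ c 0
  · rw [Set.indicator_of_mem (by exact hj)]
    refine cfMeasure_congr s fun t ht => ?_
    have ht' : t ∈ Set.Ico (0 : ℝ) 1 := ⟨ht.1.le, ht.2⟩
    simp only [Set.mem_preimage, Set.mem_inter_iff, gaussBranch_mem_digitCylinder_succ c m j ht',
      Function.iterate_succ_apply, gaussMap_gaussBranch j ht', hj, true_and]
  · rw [Set.indicator_of_notMem (by exact hj), ← measure_empty (μ := cfMeasure s)]
    refine cfMeasure_congr s fun t ht => ?_
    have ht' : t ∈ Set.Ico (0 : ℝ) 1 := ⟨ht.1.le, ht.2⟩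
    simp only [Set.mem_preimage, Set.mem_inter_iff, gaussBranch_mem_digitCylinder_succ c m j ht',
      hj, false_and, Set.mem_empty_iff_false]

theorem cfMeasure_cylinder_inter_eq_tsum (c : ℕ → Set ℕ) (m : ℕ) {s : ℝ} (hs : 0 ≤ s) {B : Set ℝ}
    (hB : MeasurableSet B) :
    cfMeasure s (digitCylinder c (m + 1) ∩ gaussMap^[m + 1] ⁻¹' B) =
      ∑' j, ENNReal.ofReal (cfWeight s j) * {d | d + 1 ∈ c 0}.indicator
        (fun _ => cfMeasure (gaussBranch j s)
          (digitCylinder (fun i => c (i + 1)) m ∩ gaussMap^[m] ⁻¹' B)) j := by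
  rw [cfMeasure_eq_tsum hs
    ((measurableSet_digitCylinder c _).inter (measurable_gaussMap.iterate _ hB))]
  simp only [cfMeasure_cylinder_inter_preimage]

theorem cfMeasure_cylinder_eq_tsum (c : ℕ → Set ℕ) (m : ℕ) {s : ℝ} (hs : 0 ≤ s) :
    cfMeasure s (digitCylinder c (m + 1)) =
      ∑' j, ENNReal.ofReal (cfWeight s j) * {d | d + 1 ∈ c 0}.indicator
        (fun _ => cfMeasure (gaussBranch j s) (digitCylinder (fun i => c (i + 1)) m)) j := by
  simpa using cfMeasure_cylinder_inter_eq_tsum c m hs MeasurableSet.univ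

theorem cfMeasure_cylinder_inter_le {B : Set ℝ} (hB : MeasurableSet B) {K : ENNReal}
    (hK : ∀ s ∈ Set.Icc (0 : ℝ) 1, cfMeasure s B ≤ K) (m : ℕ) (c : ℕ → Set ℕ) {s : ℝ}
    (hs : s ∈ Set.Icc (0 : ℝ) 1) :
    cfMeasure s (digitCylinder c m ∩ gaussMap^[m] ⁻¹' B) ≤ K * cfMeasure s (digitCylinder c m) := by
  induction m generalizing c s with
  | zero => simpa [digitCylinder, cfMeasure_univ hs.1] using hK s hs
  | succ m ih =>
    rw [cfMeasure_cylinder_inter_eq_tsum c m hs.1 hB, cfMeasure_cylinder_eq_tsum c m hs.1,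
      ← ENNReal.tsum_mul_left]
    refine ENNReal.tsum_le_tsum fun j => ?_
    rw [mul_left_comm]
    gcongr
    by_cases hj : j ∈ {d | d + 1 ∈ c 0}
    · simpa only [Set.indicator_of_mem hj] using ih _ (gaussBranch_mem_Icc j hs.1)
    · simp only [Set.indicator_of_notMem hj, zero_le]

theorem le_cfMeasure_cylinder_inter {B : Set ℝ} (hB : MeasurableSet B) {K : ENNReal}
    (hK : ∀ s ∈ Set.Icc (0 : ℝ) 1, K ≤ cfMeasure s B) (m : ℕ) (c : ℕ → Set ℕ) {s : ℝ}
    (hs : s ∈ Set.Icc (0 : ℝ) 1) :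
    K * cfMeasure s (digitCylinder c m) ≤ cfMeasure s (digitCylinder c m ∩ gaussMap^[m] ⁻¹' B) := by
  induction m generalizing c s with
  | zero => simpa [digitCylinder, cfMeasure_univ hs.1] using hK s hs
  | succ m ih =>
    rw [cfMeasure_cylinder_inter_eq_tsum c m hs.1 hB, cfMeasure_cylinder_eq_tsum c m hs.1,
      ← ENNReal.tsum_mul_left]
    refine ENNReal.tsum_le_tsum fun j => ?_
    rw [mul_left_comm]
    gcongr
    by_cases hj : j ∈ {d | d + 1 ∈ c 0}
    · simpa only [Set.indicator_of_mem hj] using ih _ (gaussBranch_mem_Icc j hs.1)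
    · simp only [Set.indicator_of_notMem hj, mul_zero, le_refl]

theorem cfMeasure_real_preimage_gaussMap {s : ℝ} (hs : 0 ≤ s) {S : Set ℝ} (hS : MeasurableSet S) :
    (cfMeasure s).real (gaussMap ⁻¹' S) =
      ∑' j, cfWeight s j * (cfMeasure (gaussBranch j s)).real S := by
  have hfin : ∀ j, cfMeasure (gaussBranch j s) S ≠ ⊤ := fun j =>
    have := isProbabilityMeasure_cfMeasure (gaussBranch_pos j hs).le
    measure_ne_top _ _
  have hpre : ∀ j, cfMeasure (gaussBranch j s) (gaussBranch j ⁻¹' (gaussMap ⁻¹' S)) =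
      cfMeasure (gaussBranch j s) S := fun j => by
    refine cfMeasure_congr _ fun t ht => ?_
    rw [Set.mem_preimage, Set.mem_preimage, gaussMap_gaussBranch j ⟨ht.1.le, ht.2⟩]
  rw [Measure.real, cfMeasure_eq_tsum hs (measurable_gaussMap hS), ENNReal.tsum_toReal_eq]
  · simp only [hpre, ENNReal.toReal_mul, ENNReal.toReal_ofReal (cfWeight_nonneg hs _), Measure.real]
  · intro j
    rw [hpre]
    exact ENNReal.mul_ne_top ENNReal.ofReal_ne_top (hfin j)

theorem cfMeasure_real_rcfDigit_one_eq {s : ℝ} (hs : 0 ≤ s) (i : ℕ) :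
    (cfMeasure s).real {x | rcfDigit x 1 = i + 1} = cfWeight s i := by
  have hpre : ∀ j, cfMeasure (gaussBranch j s) (gaussBranch j ⁻¹' {x | rcfDigit x 1 = i + 1}) =
      if j = i then 1 else 0 := fun j => by
    split_ifs with h
    · subst h
      rw [← cfMeasure_univ (gaussBranch_pos j hs).le]
      refine cfMeasure_congr _ fun t ht => ?_
      simp [rcfDigit_one_gaussBranch j ⟨ht.1.le, ht.2⟩]
    · rw [← measure_empty (μ := cfMeasure (gaussBranch j s))]
      refine cfMeasure_congr _ fun t ht => ?_
      simp [rcfDigit_one_gaussBranch j ⟨ht.1.le, ht.2⟩, h]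
  rw [Measure.real, cfMeasure_eq_tsum hs (measurableSet_rcfDigit_eq _ _)]
  simp only [hpre, mul_ite, mul_one, mul_zero, tsum_ite_eq]
  exact ENNReal.toReal_ofReal (cfWeight_nonneg hs i)

theorem abs_cfWeight_sub_le_abs_sub (j : ℕ) {s t : ℝ} (hs : s ∈ Set.Icc (0 : ℝ) 1)
    (ht : t ∈ Set.Icc (0 : ℝ) 1) : |cfWeight s j - cfWeight t j| ≤ |s - t| := by
  obtain ⟨hs0, hs1⟩ := hs
  obtain ⟨ht0, ht1⟩ := ht
  rcases Nat.eq_zero_or_pos j with rfl | hj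
  · rw [cfWeight_sub 0 hs0 ht0, abs_mul]
    refine mul_le_of_le_one_right (abs_nonneg _) ?_
    have hst := mul_nonneg hs0 ht0
    push_cast
    rw [abs_div, div_le_one (by positivity), zero_mul, zero_sub, abs_neg]
    refine abs_le_abs_of_nonneg (by positivity) (le_mul_of_one_le_right (by positivity) ?_)
    nlinarith
  · refine (abs_cfWeight_sub_le j hj ⟨hs0, hs1⟩ ⟨ht0, ht1⟩).trans
      (mul_le_of_le_one_right (abs_nonneg _) ?_)
    rw [div_le_one (by positivity)]
    have : (0 : ℝ) ≤ j := j.cast_nonneg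
    nlinarith [sq_nonneg (j : ℝ), mul_nonneg this (sq_nonneg (j : ℝ))]

theorem abs_cfMeasure_real_iterate_sub_le (i n : ℕ) {s t : ℝ} (hs : s ∈ Set.Icc (0 : ℝ) 1)
    (ht : t ∈ Set.Icc (0 : ℝ) 1) :
    |(cfMeasure s).real (gaussMap^[n] ⁻¹' {x | rcfDigit x 1 = i + 1}) -
      (cfMeasure t).real (gaussMap^[n] ⁻¹' {x | rcfDigit x 1 = i + 1})| ≤
        (51 / 56) ^ n * |s - t| := by
  induction n generalizing s t with
  | zero =>
    simp only [Function.iterate_zero, Set.preimage_id, pow_zero, one_mul]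
    rw [cfMeasure_real_rcfDigit_one_eq hs.1, cfMeasure_real_rcfDigit_one_eq ht.1]
    exact abs_cfWeight_sub_le_abs_sub i hs ht
  | succ n ih =>
    have hmeas := measurable_gaussMap.iterate n (measurableSet_rcfDigit_eq 1 (i + 1))
    rw [Function.iterate_succ, Set.preimage_comp, cfMeasure_real_preimage_gaussMap hs.1 hmeas,
      cfMeasure_real_preimage_gaussMap ht.1 hmeas, pow_succ']
    exact abs_tsum_cfWeight_sub_le
      (h := fun u => (cfMeasure u).real (gaussMap^[n] ⁻¹' {x | rcfDigit x 1 = i + 1}))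
      (fun x hx y hy => ih hx hy) hs ht

theorem le_gaussMeasure {S : Set ℝ} (hS : MeasurableSet S) {K : ENNReal}
    (hK : ∀ s ∈ Set.Icc (0 : ℝ) 1, K ≤ cfMeasure s S) :
    ENNReal.ofReal (Real.log 2) * K ≤ gaussMeasure S := by
  rw [gaussMeasure_eq_lintegral_cfMeasure hS, ← gaussMeasure_univ,
    gaussMeasure_apply MeasurableSet.univ, ← lintegral_mul_const _ (by simp; fun_prop)]
  refine setLIntegral_mono' measurableSet_Ioo fun s hs => ?_
  simp only [Set.indicator_univ, Pi.one_apply, mul_one]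
  gcongr
  exact hK s ⟨hs.1.le, hs.2.le⟩

theorem gaussMeasure_le {S : Set ℝ} (hS : MeasurableSet S) {K : ENNReal}
    (hK : ∀ s ∈ Set.Icc (0 : ℝ) 1, cfMeasure s S ≤ K) :
    gaussMeasure S ≤ ENNReal.ofReal (Real.log 2) * K := by
  rw [gaussMeasure_eq_lintegral_cfMeasure hS, ← gaussMeasure_univ,
    gaussMeasure_apply MeasurableSet.univ, ← lintegral_mul_const _ (by simp; fun_prop)]
  refine setLIntegral_mono' measurableSet_Ioo fun s hs => ?_
  simp only [Set.indicator_univ, Pi.one_apply, mul_one]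
  gcongr
  exact hK s ⟨hs.1.le, hs.2.le⟩

/-- Gauss–Kuzmin theorem with exponential rate, uniformly over the measures `cfMeasure s`. -/
theorem abs_cfMeasure_real_rcfDigit_sub_le {r : ℕ} (hr : 0 < r) (n : ℕ) {s : ℝ}
    (hs : s ∈ Set.Icc (0 : ℝ) 1) :
    |(cfMeasure s).real {x | rcfDigit x (n + 1) = r} -
      Real.log (1 + 1 / ((r : ℝ) * ((r : ℝ) + 2))) / Real.log 2| ≤ (51 / 56) ^ n := by
  obtain ⟨i, rfl⟩ : ∃ i, r = i + 1 := ⟨r - 1, by omega⟩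
  have hset : {x | rcfDigit x (n + 1) = i + 1} =
      gaussMap^[n] ⁻¹' {x | rcfDigit x 1 = i + 1} := by
    ext x
    simp only [Set.mem_ofPred_eq, Set.mem_preimage]
    rw [rcfDigit_add x n 0]
  rw [hset]
  set S := gaussMap^[n] ⁻¹' {x | rcfDigit x 1 = i + 1} with hSdef
  have hS : MeasurableSet S :=
    measurable_gaussMap.iterate n (measurableSet_rcfDigit_eq 1 (i + 1))
  have hosc : ∀ t ∈ Set.Icc (0 : ℝ) 1,
      |(cfMeasure t).real S - (cfMeasure s).real S| ≤ (51 / 56) ^ n := fun t ht => by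
    refine (abs_cfMeasure_real_iterate_sub_le i n ht hs).trans
      (mul_le_of_le_one_right (by positivity) ?_)
    rw [abs_le]
    constructor <;> linarith [ht.1, ht.2, hs.1, hs.2]
  have hfin : ∀ t ∈ Set.Icc (0 : ℝ) 1, ENNReal.ofReal ((cfMeasure t).real S) = cfMeasure t S :=
    fun t ht =>
      have := isProbabilityMeasure_cfMeasure ht.1
      ofReal_measureReal
  have hlog2 : 0 < Real.log 2 := Real.log_pos one_lt_two
  have hlog : 0 ≤ Real.log (1 + 1 / (((i + 1 : ℕ) : ℝ) * (((i + 1 : ℕ) : ℝ) + 2))) :=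
    Real.log_nonneg (le_add_of_nonneg_right (by positivity))
  have hgauss : gaussMeasure S = ENNReal.ofReal _ :=
    (gaussMeasure_preimage_iterate (measurableSet_rcfDigit_eq 1 (i + 1)) n).trans
      (gaussMeasure_rcfDigit_one_eq i.succ_pos)
  have hlow := le_gaussMeasure hS
    (K := ENNReal.ofReal ((cfMeasure s).real S - (51 / 56) ^ n)) fun t ht => by
      rw [← hfin t ht]
      exact ENNReal.ofReal_le_ofReal (by linarith [(abs_le.1 (hosc t ht)).1])
  have hupp := gaussMeasure_le hS
    (K := ENNReal.ofReal ((cfMeasure s).real S + (51 / 56) ^ n)) fun t ht => by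
      rw [← hfin t ht]
      exact ENNReal.ofReal_le_ofReal (by linarith [(abs_le.1 (hosc t ht)).2])
  rw [hgauss, ← ENNReal.ofReal_mul hlog2.le, ENNReal.ofReal_le_ofReal_iff hlog] at hlow
  rw [hgauss, ← ENNReal.ofReal_mul hlog2.le, ENNReal.ofReal_le_ofReal_iff
    (mul_nonneg hlog2.le (add_nonneg measureReal_nonneg (by positivity)))] at hupp
  rw [abs_le]
  constructor
  · rw [neg_le_sub_iff_le_add, div_le_iff₀ hlog2]
    linarith
  · rw [sub_le_comm, le_div_iff₀ hlog2]
    linarith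

theorem abs_cfMeasure_cylinder_cond_sub_le (c : ℕ → Set ℕ) (m n : ℕ) {r : ℕ} (hr : 0 < r) {s : ℝ}
    (hs : s ∈ Set.Icc (0 : ℝ) 1) (hpos : 0 < (cfMeasure s).real (digitCylinder c m)) :
    |(cfMeasure s).real (digitCylinder c m ∩ {x | rcfDigit x (m + (n + 1)) = r}) /
        (cfMeasure s).real (digitCylinder c m) -
      Real.log (1 + 1 / ((r : ℝ) * ((r : ℝ) + 2))) / Real.log 2| ≤ (51 / 56) ^ n := by
  have hset : {x | rcfDigit x (m + (n + 1)) = r} =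
      gaussMap^[m] ⁻¹' {x | rcfDigit x (n + 1) = r} := by
    ext x
    simp only [Set.mem_ofPred_eq, Set.mem_preimage]
    rw [rcfDigit_add x m n]
  rw [hset]
  set g := Real.log (1 + 1 / ((r : ℝ) * ((r : ℝ) + 2))) / Real.log 2
  have hB := measurableSet_rcfDigit_eq (n + 1) r
  have hfin : ∀ t ∈ Set.Icc (0 : ℝ) 1, ∀ S, ENNReal.ofReal ((cfMeasure t).real S) = cfMeasure t S :=
    fun t ht S =>
      have := isProbabilityMeasure_cfMeasure ht.1
      ofReal_measureReal
  have hupp := cfMeasure_cylinder_inter_le hB (K := ENNReal.ofReal (g + (51 / 56) ^ n))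
    (fun t ht => by
      rw [← hfin t ht]
      exact ENNReal.ofReal_le_ofReal
        (by linarith [(abs_le.1 (abs_cfMeasure_real_rcfDigit_sub_le hr n ht)).2])) m c hs
  have hlow := le_cfMeasure_cylinder_inter hB (K := ENNReal.ofReal (g - (51 / 56) ^ n))
    (fun t ht => by
      rw [← hfin t ht]
      exact ENNReal.ofReal_le_ofReal
        (by linarith [(abs_le.1 (abs_cfMeasure_real_rcfDigit_sub_le hr n ht)).1])) m c hs
  have hg : 0 ≤ g := div_nonneg
    (Real.log_nonneg (le_add_of_nonneg_right (by positivity))) (Real.log_nonneg one_le_two)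
  rw [← hfin s hs, ← hfin s hs, ← ENNReal.ofReal_mul (by positivity),
    ENNReal.ofReal_le_ofReal_iff (by positivity)] at hupp
  rw [← hfin s hs, ← hfin s hs, ← ENNReal.ofReal_mul' hpos.le,
    ENNReal.ofReal_le_ofReal_iff measureReal_nonneg] at hlow
  rw [abs_le]
  constructor
  · rw [neg_le_sub_iff_le_add', ← sub_le_iff_le_add', le_div_iff₀ hpos]
    linarith
  · rw [sub_le_iff_le_add', div_le_iff₀ hpos]
    linarith

theorem volume_Ioo_irrational_inter (S : Set ℝ) :
    volume {x : ℝ | x ∈ Set.Ioo (0 : ℝ) 1 ∧ Irrational x ∧ x ∈ S} = cfMeasure 0 S := by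
  have hirr : ∀ᵐ x : ℝ, Irrational x := by
    have := (Set.countable_range ((↑) : ℚ → ℝ)).measure_zero volume
    exact measure_eq_zero_iff_ae_notMem.1 this
  rw [cfMeasure_zero, Measure.restrict_apply' measurableSet_Ioo]
  refine measure_congr ?_
  filter_upwards [hirr] with x hx
  exact propext ⟨fun h => ⟨h.2.2, h.1⟩, fun h => ⟨h.2, hx, h.1⟩⟩

/-- Mixing estimate for regular continued fraction digits: the conditional
probability of `a_{k_{n+1}} = r` given the cylinder `a_{k₁} = r₁, …, a_{kₙ} = rₙ`
(with `k₁ < ⋯ < kₙ < k_{n+1}`) is exponentially close (in `√(k_{n+1} - kₙ)`) to the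
Gauss–Kuzmin frequency `log(1 + 1/(r(r+2)))/log 2`.  (For `n = 0` the previous index
`kₙ` is read as `0`, via the `sup` of the empty set.) -/
theorem rcf_cylinder_cond_mixing :
    ∃ B β : ℝ, 0 < B ∧ 0 < β ∧ ∀ (n : ℕ) (k : Fin (n + 1) → ℕ) (r : Fin (n + 1) → ℕ),
      (∀ i, 0 < k i) → StrictMono k → (∀ i, 0 < r i) →
      0 < volume {x : ℝ | x ∈ Set.Ioo (0 : ℝ) 1 ∧ Irrational x ∧
            ∀ i : Fin n, rcfDigit x (k i.castSucc) = r i.castSucc} →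
      |(volume {x : ℝ | x ∈ Set.Ioo (0 : ℝ) 1 ∧ Irrational x ∧
            (∀ i : Fin n, rcfDigit x (k i.castSucc) = r i.castSucc) ∧
            rcfDigit x (k (Fin.last n)) = r (Fin.last n)}).toReal /
          (volume {x : ℝ | x ∈ Set.Ioo (0 : ℝ) 1 ∧ Irrational x ∧
            ∀ i : Fin n, rcfDigit x (k i.castSucc) = r i.castSucc}).toReal -
          Real.log (1 + 1 / ((r (Fin.last n) : ℝ) * ((r (Fin.last n) : ℝ) + 2))) / Real.log 2|
        < B * Real.exp (-β * Real.sqrt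
            ((k (Fin.last n) - Finset.univ.sup fun i : Fin n => k i.castSucc : ℕ) : ℝ)) := by
  refine ⟨112 / 51, -Real.log (51 / 56), by norm_num,
    neg_pos.2 (Real.log_neg (by norm_num) (by norm_num)), ?_⟩
  intro n k r hk hmono hr hpos
  set m := Finset.univ.sup fun i : Fin n => k i.castSucc with hm
  obtain ⟨d, hd⟩ : ∃ d, k (Fin.last n) = m + (d + 1) := by
    have hlt : m < k (Fin.last n) :=
      (Finset.sup_lt_iff (hk _)).2 fun i _ => hmono i.castSucc_lt_last
    exact ⟨k (Fin.last n) - m - 1, by omega⟩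
  set c : ℕ → Set ℕ := fun j => {a | ∀ i : Fin n, k i.castSucc = j + 1 → a = r i.castSucc}
  have hcyl : ∀ x, (∀ i : Fin n, rcfDigit x (k i.castSucc) = r i.castSucc) ↔
      x ∈ digitCylinder c m := by
    intro x
    constructor
    · intro h j _ i hi
      rw [← hi, h i]
    · intro h i
      have hki := hk i.castSucc
      have hle : k i.castSucc ≤ m :=
        Finset.le_sup (f := fun i : Fin n => k i.castSucc) (Finset.mem_univ i)
      have := h (k i.castSucc - 1) (by omega) i (by omega)
      rwa [Nat.sub_add_cancel hki] at this
  have hden : volume {x : ℝ | x ∈ Set.Ioo (0 : ℝ) 1 ∧ Irrational x ∧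
      ∀ i : Fin n, rcfDigit x (k i.castSucc) = r i.castSucc} =
      cfMeasure 0 (digitCylinder c m) := by
    simp only [hcyl]
    exact volume_Ioo_irrational_inter _
  have hnum : volume {x : ℝ | x ∈ Set.Ioo (0 : ℝ) 1 ∧ Irrational x ∧
      (∀ i : Fin n, rcfDigit x (k i.castSucc) = r i.castSucc) ∧
      rcfDigit x (k (Fin.last n)) = r (Fin.last n)} =
      cfMeasure 0 (digitCylinder c m ∩ {x | rcfDigit x (m + (d + 1)) = r (Fin.last n)}) := by
    simp only [hcyl, hd]
    exact volume_Ioo_irrational_inter _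
  rw [hden] at hpos
  rw [hden, hnum, hd, Nat.add_sub_cancel_left]
  have := isProbabilityMeasure_cfMeasure le_rfl
  refine (abs_cfMeasure_cylinder_cond_sub_le c m d (hr _) (by simp)
    (ENNReal.toReal_pos hpos.ne' (measure_ne_top _ _))).trans_lt ?_
  have hsqrt : √((d + 1 : ℕ) : ℝ) ≤ (d + 1 : ℕ) := by
    rw [Real.sqrt_le_left (by positivity)]
    have : (1 : ℝ) ≤ (d + 1 : ℕ) := by exact_mod_cast d.succ_pos
    nlinarith
  have hexp : (51 / 56 : ℝ) ^ (d + 1) ≤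
      Real.exp (- -Real.log (51 / 56) * √((d + 1 : ℕ) : ℝ)) := by
    rw [← Real.rpow_natCast, Real.rpow_def_of_pos (by norm_num), neg_neg, Real.exp_le_exp]
    exact mul_le_mul_of_nonpos_left hsqrt (Real.log_nonpos (by norm_num) (by norm_num))
  have hpow : (0 : ℝ) < (51 / 56) ^ d := by positivity
  rw [pow_succ] at hexp
  linarith
end

section
/- For Lebesgue-almost every irrational x ∈ (0,1), the frequency of the digit 2 in the negative continued fraction expansion is 1: lim_{n→∞} (1/n) · #{1 ≤ i ≤ n : a'_i(x) = 2} = 1. -/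
open MeasureTheory Filter Real

/-- The negative continued fraction map `T(y) = -1/y - ⌊-1/y⌋` (with `T 0 = 0`). -/
noncomputable def negT (y : ℝ) : ℝ := Int.fract (-1 / y)

/-- The `n`-th negative continued fraction digit `a'_n(x) = ⌈1 / T^{n-1}(1-x)⌉`. -/
noncomputable def negDigit (x : ℝ) (n : ℕ) : ℕ := (⌈1 / negT^[n - 1] (1 - x)⌉).toNat

/-- The summand `1 / ((1 + n v) (1 + (n + 1) v))` of the telescoping expansion of `1 / v`. -/
noncomputable def cfTerm (n : ℕ) (v : ℝ) : ℝ := 1 / ((1 + n * v) * (1 + (n + 1) * v))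

/-- The mass lost by a discounted sum of the terms `cfTerm n v`, truncated at order `N`. -/
noncomputable def discountDefect (N : ℕ) (q : ℝ) : ℝ :=
  ∑ n ∈ Finset.range N, (1 - q ^ (n + 1)) / ((2 * n + 3) * (2 * n + 5))

lemma cfTerm_nonneg (n : ℕ) {v : ℝ} (hv : 0 ≤ v) : 0 ≤ cfTerm n v := by
  unfold cfTerm; positivity

lemma cfTerm_le_one (n : ℕ) {v : ℝ} (hv : 0 ≤ v) : cfTerm n v ≤ 1 := by
  unfold cfTerm
  rw [div_le_one (by positivity)]
  have h1 : 1 ≤ 1 + n * v := by linarith [mul_nonneg n.cast_nonneg hv]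
  have h2 : 1 ≤ 1 + (n + 1) * v := by nlinarith [mul_nonneg n.cast_nonneg hv]
  nlinarith

lemma cfTerm_succ (n : ℕ) {v : ℝ} (hv : 0 ≤ v) :
    1 / (1 + v) ^ 2 * cfTerm n (v / (1 + v)) = cfTerm (n + 1) v := by
  unfold cfTerm
  have h1 : 1 + n * (v / (1 + v)) = (1 + (n + 1) * v) / (1 + v) := by field_simp; ring
  have h2 : 1 + (n + 1) * (v / (1 + v)) = (1 + (n + 2) * v) / (1 + v) := by field_simp; ring
  have h3 : 0 < 1 + (n + 1) * v := by positivity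
  have h4 : 0 < 1 + (n + 2) * v := by positivity
  rw [h1, h2]
  push_cast
  rw [show (n : ℝ) + 1 + 1 = n + 2 by ring]
  field_simp

lemma sum_cfTerm_succ (L : ℕ) {v : ℝ} (hv : 0 < v) :
    ∑ n ∈ Finset.range L, cfTerm (n + 1) v
      = 1 / (v * (1 + v)) - 1 / (v * (1 + (L + 1) * v)) := by
  induction L with
  | zero => simp
  | succ L ih =>
    rw [Finset.sum_range_succ, ih]
    unfold cfTerm
    have h3 : 0 < 1 + (L + 1) * v := by positivity
    have h4 : 0 < 1 + (L + 1 + 1) * v := by positivity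
    push_cast
    field_simp
    ring

lemma sum_cfTerm_succ_le (L : ℕ) {v : ℝ} (hv : 0 < v) :
    ∑ n ∈ Finset.range L, cfTerm (n + 1) v ≤ 1 / (v * (1 + v)) := by
  rw [sum_cfTerm_succ L hv]
  have : 0 ≤ 1 / (v * (1 + (L + 1) * v)) := by positivity
  linarith

lemma sum_discounted_cfTerm_le (L : ℕ) {q v : ℝ} (hq0 : 0 ≤ q) (hq1 : q ≤ 1) (hv : 0 < v) :
    ∑ n ∈ Finset.range L, q ^ (n + 1) * cfTerm (n + 1) v ≤ 1 / (v * (1 + v)) := by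
  refine le_trans (Finset.sum_le_sum fun n _ => ?_) (sum_cfTerm_succ_le L hv)
  exact mul_le_of_le_one_left (cfTerm_nonneg _ hv.le) (pow_le_one₀ hq0 hq1)

lemma sum_discounted_cfTerm_le_sub (L N : ℕ) {q v : ℝ} (hq0 : 0 ≤ q) (hq1 : q ≤ 1)
    (hv : 0 < v) (hv2 : v ≤ 2) :
    ∑ n ∈ Finset.range L, q ^ (n + 1) * cfTerm (n + 1) v
      ≤ 1 / (v * (1 + v)) - discountDefect N q := by
  have hmono : ∑ n ∈ Finset.range L, q ^ (n + 1) * cfTerm (n + 1) v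
      ≤ ∑ n ∈ Finset.range (max L N), q ^ (n + 1) * cfTerm (n + 1) v :=
    Finset.sum_le_sum_of_subset_of_nonneg (Finset.range_mono (le_max_left _ _))
      fun n _ _ => mul_nonneg (pow_nonneg hq0 _) (cfTerm_nonneg _ hv.le)
  have hdefect : discountDefect N q
      ≤ ∑ n ∈ Finset.range (max L N), (1 - q ^ (n + 1)) * cfTerm (n + 1) v := by
    refine le_trans (Finset.sum_le_sum fun n _ => ?_)
      (Finset.sum_le_sum_of_subset_of_nonneg (Finset.range_mono (le_max_right _ _))
        fun n _ _ => mul_nonneg (sub_nonneg.2 (pow_le_one₀ hq0 hq1)) (cfTerm_nonneg _ hv.le))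
    rw [div_eq_mul_one_div]
    refine mul_le_mul_of_nonneg_left ?_ (sub_nonneg.2 (pow_le_one₀ hq0 hq1))
    unfold cfTerm
    push_cast
    have hn : (0 : ℝ) ≤ n := n.cast_nonneg
    apply one_div_le_one_div_of_le (by positivity)
    apply mul_le_mul <;> first | positivity | nlinarith
  have hsum := sum_cfTerm_succ_le (max L N) hv
  have hsplit : ∑ n ∈ Finset.range (max L N), cfTerm (n + 1) v
      = ∑ n ∈ Finset.range (max L N), q ^ (n + 1) * cfTerm (n + 1) v
        + ∑ n ∈ Finset.range (max L N), (1 - q ^ (n + 1)) * cfTerm (n + 1) v := by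
    rw [← Finset.sum_add_distrib]
    exact Finset.sum_congr rfl fun n _ => by ring
  linarith

lemma discountDefect_nonneg (N : ℕ) {q : ℝ} (hq0 : 0 ≤ q) (hq1 : q ≤ 1) :
    0 ≤ discountDefect N q :=
  Finset.sum_nonneg fun n _ => div_nonneg (sub_nonneg.2 (pow_le_one₀ hq0 hq1)) (by positivity)

lemma discountDefect_lt_one (N : ℕ) {q : ℝ} (hq0 : 0 ≤ q) (hq1 : q ≤ 1) :
    discountDefect N q < 1 := by
  have := sum_discounted_cfTerm_le_sub 0 N hq0 hq1 one_pos one_le_two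
  norm_num at this
  linarith

/-- The defect is not linear in `1 - q`: its ratio to `1 - q` exceeds any bound. -/
lemma exists_mul_lt_discountDefect (m : ℝ) :
    ∃ (N : ℕ) (q : ℝ), 0 < q ∧ q < 1 ∧ m * (1 - q) < discountDefect N q := by
  have hfactor : ∀ (N : ℕ) (q : ℝ), discountDefect N q = (∑ n ∈ Finset.range N,
      (∑ i ∈ Finset.range (n + 1), q ^ i) / ((2 * n + 3) * (2 * n + 5))) * (1 - q) := by
    intro N q
    rw [discountDefect, Finset.sum_mul]
    refine Finset.sum_congr rfl fun n _ => ?_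
    rw [div_mul_eq_mul_div, geom_sum_mul_neg]
  obtain ⟨N, hN⟩ : ∃ N : ℕ, 15 * m < ∑ n ∈ Finset.range N, 1 / ((n : ℝ) + 1) :=
    (Real.tendsto_sum_range_one_div_nat_succ_atTop.eventually_gt_atTop (15 * m)).exists
  have hone : m < ∑ n ∈ Finset.range N,
      (∑ i ∈ Finset.range (n + 1), (1 : ℝ) ^ i) / ((2 * n + 3) * (2 * n + 5)) := by
    have hle : (1 / 15 : ℝ) * ∑ n ∈ Finset.range N, 1 / ((n : ℝ) + 1)
        ≤ ∑ n ∈ Finset.range N,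
          (∑ i ∈ Finset.range (n + 1), (1 : ℝ) ^ i) / ((2 * n + 3) * (2 * n + 5)) := by
      rw [Finset.mul_sum]
      refine Finset.sum_le_sum fun n _ => ?_
      have hn : (0 : ℝ) ≤ n := n.cast_nonneg
      simp only [one_pow, Finset.sum_const, Finset.card_range, nsmul_eq_mul, mul_one]
      push_cast
      rw [div_mul_div_comm, div_le_div_iff₀ (by positivity) (by positivity)]
      nlinarith
    linarith
  have hcont : Continuous fun q : ℝ => ∑ n ∈ Finset.range N,
      (∑ i ∈ Finset.range (n + 1), q ^ i) / ((2 * n + 3) * (2 * n + 5)) := by fun_prop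
  have hnear : ∀ᶠ q in nhdsWithin (1 : ℝ) (Set.Iio 1), m < ∑ n ∈ Finset.range N,
      (∑ i ∈ Finset.range (n + 1), q ^ i) / ((2 * (n : ℝ) + 3) * (2 * n + 5)) :=
    (hcont.tendsto 1).eventually_const_lt hone |>.filter_mono nhdsWithin_le_nhds
  obtain ⟨q, hq, hq0, hq1⟩ := (hnear.and (Ioo_mem_nhdsLT (zero_lt_one' ℝ))).exists
  refine ⟨N, q, hq0, hq1, ?_⟩
  rw [hfactor]
  exact mul_lt_mul_of_pos_right hq (by linarith)

lemma sum_range_one_div_mul_succ (L : ℕ) {c : ℝ} (hc : 0 < c) :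
    ∑ j ∈ Finset.range L, 1 / ((c + j) * (1 + (c + j))) = 1 / c - 1 / (c + L) := by
  induction L with
  | zero => simp
  | succ L ih =>
    rw [Finset.sum_range_succ, ih]
    have : 0 < c + L := by positivity
    push_cast
    field_simp
    ring

/-- A density dominated by `1 / (1 - y)`, obtained by discounting at rate `q` the expansion of the
invariant density of `negT` along excursions near the neutral fixed point. -/
noncomputable def discountDensity (q y : ℝ) : ENNReal :=
  ∑' n : ℕ, ENNReal.ofReal (q ^ n * cfTerm n (1 - y))

/-- The weight of one step of `negT`: a discount `q`, and a reward `r` if the digit is not `2`. -/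
noncomputable def stepWeight (q r y : ℝ) : ENNReal :=
  ENNReal.ofReal (q * if y < 1 / 2 then r else 1)

lemma measurable_negT : Measurable negT := by
  unfold negT; fun_prop

lemma measurable_stepWeight (q r : ℝ) : Measurable (stepWeight q r) := by
  unfold stepWeight
  exact (measurable_const.mul (Measurable.ite measurableSet_Iio measurable_const
    measurable_const)).ennreal_ofReal

lemma measurable_discountDensity (q : ℝ) : Measurable (discountDensity q) := by
  unfold discountDensity cfTerm
  fun_prop

lemma half_le_discountDensity (q : ℝ) {y : ℝ} (hy : y ∈ Set.Ico (0 : ℝ) 1) :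
    ENNReal.ofReal (1 / 2) ≤ discountDensity q y := by
  refine le_trans (ENNReal.ofReal_le_ofReal ?_) (ENNReal.le_tsum 0)
  have h0 := hy.1
  have h1 := hy.2
  simp only [cfTerm, pow_zero, Nat.cast_zero, zero_mul, add_zero, zero_add, one_mul]
  exact one_div_le_one_div_of_le (by linarith) (by linarith)

lemma lintegral_discountDensity_ne_top {q : ℝ} (hq0 : 0 ≤ q) (hq1 : q < 1) :
    ∫⁻ y in Set.Ico (0 : ℝ) 1, discountDensity q y ≠ ⊤ := by
  have hle : ∀ y ∈ Set.Ico (0 : ℝ) 1, discountDensity q y ≤ ENNReal.ofReal (1 - q)⁻¹ := by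
    intro y hy
    rw [← tsum_geometric_of_lt_one hq0 hq1, ENNReal.ofReal_tsum_of_nonneg
      (fun n => pow_nonneg hq0 n) (summable_geometric_of_lt_one hq0 hq1)]
    refine ENNReal.tsum_le_tsum fun n => ENNReal.ofReal_le_ofReal ?_
    exact mul_le_of_le_one_right (pow_nonneg hq0 n) (cfTerm_le_one n (by linarith [hy.2]))
  refine ne_top_of_le_ne_top ?_ (setLIntegral_mono' measurableSet_Ico hle)
  simp

lemma discountDensity_branch {q v : ℝ} (hq : 0 ≤ q) (hv : 0 ≤ v) :
    ENNReal.ofReal q * (ENNReal.ofReal (1 / (1 + v) ^ 2) * discountDensity q (1 / (1 + v)))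
      = ∑' n : ℕ, ENNReal.ofReal (q ^ (n + 1) * cfTerm (n + 1) v) := by
  rw [discountDensity, ← ENNReal.tsum_mul_left, ← ENNReal.tsum_mul_left]
  refine tsum_congr fun n => ?_
  rw [← ENNReal.ofReal_mul (by positivity), ← ENNReal.ofReal_mul hq]
  congr 1
  rw [← cfTerm_succ n hv, show 1 - 1 / (1 + v) = v / (1 + v) by field_simp; ring]
  ring

/-- `discountDensity q` is a supersolution of the weighted transfer operator of `negT`. -/
lemma tsum_branch_discountDensity_le {N : ℕ} {q r x : ℝ} (hq0 : 0 ≤ q) (hq1 : q ≤ 1)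
    (hr0 : 0 ≤ r) (hr : r * (1 - discountDefect N q) ≤ 1) (hx : x ∈ Set.Ico (0 : ℝ) 1) :
    ∑' k : ℕ, ENNReal.ofReal (1 / (k + 2 - x) ^ 2) *
      (stepWeight q r (1 / (k + 2 - x)) * discountDensity q (1 / (k + 2 - x)))
      ≤ discountDensity q x := by
  obtain ⟨u, rfl⟩ : ∃ u, x = 1 - u := ⟨1 - x, by ring⟩
  have hu0 : 0 < u := by linarith [hx.2]
  have hu1 : u ≤ 1 := by linarith [hx.1]
  set S : ℝ → ENNReal := fun v => ∑' n : ℕ, ENNReal.ofReal (q ^ (n + 1) * cfTerm (n + 1) v)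
    with hS
  have hD := discountDefect_nonneg N hq0 hq1
  have hhead : ENNReal.ofReal (1 / (((0 : ℕ) : ℝ) + 2 - (1 - u)) ^ 2) *
      (stepWeight q r (1 / (((0 : ℕ) : ℝ) + 2 - (1 - u))) *
        discountDensity q (1 / (((0 : ℕ) : ℝ) + 2 - (1 - u)))) = S u := by
    rw [show ((0 : ℕ) : ℝ) + 2 - (1 - u) = 1 + u by push_cast; ring, hS]
    simp only
    rw [← discountDensity_branch hq0 hu0.le, stepWeight, if_neg, mul_one]
    · ring
    · rw [not_lt]
      exact one_div_le_one_div_of_le (by linarith) (by linarith)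
  have htail : ∀ k : ℕ, ENNReal.ofReal (1 / (((k + 1 : ℕ) : ℝ) + 2 - (1 - u)) ^ 2) *
      (stepWeight q r (1 / (((k + 1 : ℕ) : ℝ) + 2 - (1 - u))) *
        discountDensity q (1 / (((k + 1 : ℕ) : ℝ) + 2 - (1 - u))))
      = ENNReal.ofReal r * S (1 + u + k) := by
    intro k
    have hk : (0 : ℝ) ≤ k := k.cast_nonneg
    rw [show ((k + 1 : ℕ) : ℝ) + 2 - (1 - u) = 1 + (1 + u + k) by push_cast; ring, hS]
    simp only
    rw [← discountDensity_branch hq0 (by positivity), stepWeight, if_pos, ENNReal.ofReal_mul hq0]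
    · ring
    · exact one_div_lt_one_div_of_lt (by norm_num) (by linarith)
  have hsumS : ∑' k : ℕ, S (1 + u + k) ≤ ENNReal.ofReal (1 / (1 + u) - discountDefect N q) := by
    set b : ℕ → ℝ := fun j => 1 / ((1 + u + j) * (1 + (1 + u + j)))
      - if j = 0 then discountDefect N q else 0 with hb
    have hpartial : ∀ j L : ℕ, ∑ n ∈ Finset.range L,
        q ^ (n + 1) * cfTerm (n + 1) (1 + u + j) ≤ b j := by
      intro j L
      have hj : (0 : ℝ) ≤ j := j.cast_nonneg
      by_cases h : j = 0
      · subst h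
        simpa [hb] using sum_discounted_cfTerm_le_sub L N hq0 hq1
          (show 0 < 1 + u by linarith) (by linarith)
      · simpa [hb, h] using sum_discounted_cfTerm_le L hq0 hq1 (show 0 < 1 + u + j by linarith)
    have hb0 : ∀ j, 0 ≤ b j := fun j => by simpa using hpartial j 0
    have hSb : ∀ j : ℕ, S (1 + u + j) ≤ ENNReal.ofReal (b j) := by
      intro j
      have hj : (0 : ℝ) ≤ 1 + u + j := by positivity
      refine ENNReal.tsum_le_of_sum_range_le fun L => ?_
      rw [← ENNReal.ofReal_sum_of_nonneg
        fun n _ => mul_nonneg (pow_nonneg hq0 _) (cfTerm_nonneg _ hj)]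
      exact ENNReal.ofReal_le_ofReal (hpartial j L)
    refine (ENNReal.tsum_le_tsum hSb).trans (ENNReal.tsum_le_of_sum_range_le fun L => ?_)
    rw [← ENNReal.ofReal_sum_of_nonneg fun j _ => hb0 j]
    refine ENNReal.ofReal_le_ofReal ?_
    have hmono : ∑ j ∈ Finset.range L, b j ≤ ∑ j ∈ Finset.range (L + 1), b j := by
      rw [Finset.sum_range_succ]
      linarith [hb0 L]
    refine hmono.trans ?_
    rw [hb, Finset.sum_sub_distrib, sum_range_one_div_mul_succ _ (by linarith)]
    simp only [Finset.sum_ite_eq', Finset.mem_range, Nat.succ_pos, if_true]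
    have : 0 ≤ 1 / (1 + u + ((L + 1 : ℕ) : ℝ)) := by positivity
    linarith
  have hfinal : r * (1 / (1 + u) - discountDefect N q) ≤ 1 / (1 + u) := by
    have h1 : 1 / (1 + u) - discountDefect N q ≤ (1 - discountDefect N q) / (1 + u) := by
      rw [sub_div, sub_le_sub_iff_left]
      exact div_le_self hD (by linarith : 1 ≤ 1 + u)
    calc r * (1 / (1 + u) - discountDefect N q)
        ≤ r * ((1 - discountDefect N q) / (1 + u)) := mul_le_mul_of_nonneg_left h1 hr0
      _ = r * (1 - discountDefect N q) / (1 + u) := by ring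
      _ ≤ 1 / (1 + u) := div_le_div_of_nonneg_right hr (by linarith)
  have hexpand : discountDensity q (1 - u) = ENNReal.ofReal (q ^ 0 * cfTerm 0 u) + S u := by
    rw [discountDensity, tsum_eq_zero_add' ENNReal.summable, sub_sub_cancel]
  rw [tsum_eq_zero_add' ENNReal.summable, hhead, tsum_congr htail, ENNReal.tsum_mul_left,
    hexpand, add_comm]
  refine add_le_add ?_ le_rfl
  refine (mul_le_mul_right hsumS (ENNReal.ofReal r)).trans ?_
  rw [← ENNReal.ofReal_mul hr0]
  refine ENNReal.ofReal_le_ofReal (hfinal.trans_eq ?_)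
  simp [cfTerm]

lemma lintegral_le_tsum_branch (F : ℝ → ENNReal) :
    ∫⁻ y in Set.Ico (0 : ℝ) 1, F y
      ≤ ∑' k : ℕ, ∫⁻ x in Set.Ico (0 : ℝ) 1,
          ENNReal.ofReal (1 / (k + 2 - x) ^ 2) * F (1 / (k + 2 - x)) := by
  have hcover : Set.Ioo (0 : ℝ) 1
      ⊆ ⋃ k : ℕ, (fun x : ℝ => 1 / ((k : ℝ) + 2 - x)) '' Set.Ico (0 : ℝ) 1 := by
    intro y hy
    have h1 : 1 < 1 / y := (one_lt_div hy.1).2 hy.2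
    have h2 : 2 ≤ ⌈1 / y⌉₊ := Nat.lt_ceil.2 (by simpa using h1)
    have h3 := Nat.le_ceil (1 / y)
    have h4 := Nat.ceil_lt_add_one (zero_le_one.trans h1.le)
    have h5 : ((⌈1 / y⌉₊ - 2 : ℕ) : ℝ) = ⌈1 / y⌉₊ - 2 := by push_cast [h2]; ring
    refine Set.mem_iUnion.2 ⟨⌈1 / y⌉₊ - 2, ⌈1 / y⌉₊ - 1 / y, ⟨by linarith, by linarith⟩, ?_⟩
    simp only [h5]
    rw [show (⌈1 / y⌉₊ : ℝ) - 2 + 2 - (⌈1 / y⌉₊ - 1 / y) = 1 / y by ring, one_div_one_div]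
  rw [← setLIntegral_congr Ioo_ae_eq_Ico]
  refine (lintegral_mono_set hcover).trans ((lintegral_iUnion_le _ _).trans ?_)
  refine ENNReal.tsum_le_tsum fun k => ?_
  have hpos : ∀ x ∈ Set.Ico (0 : ℝ) 1, 0 < (k : ℝ) + 2 - x := fun x hx => by
    have : (0 : ℝ) ≤ k := k.cast_nonneg
    linarith [hx.2]
  rw [lintegral_image_eq_lintegral_abs_deriv_mul (f' := fun x => 1 / ((k : ℝ) + 2 - x) ^ 2)
    measurableSet_Ico]
  · simp
  · intro x hx
    have h := ((hasDerivAt_id x).const_sub ((k : ℝ) + 2)).fun_inv (hpos x hx).ne'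
    simpa [one_div] using h.hasDerivWithinAt
  · intro x hx y hy hxy
    simp only [one_div, inv_inj] at hxy
    linarith

lemma negT_branch (k : ℕ) {x : ℝ} (hx : x ∈ Set.Ico (0 : ℝ) 1) :
    negT (1 / (k + 2 - x)) = x := by
  rw [negT, Int.fract_eq_iff]
  refine ⟨hx.1, hx.2, -(k + 2), ?_⟩
  rw [neg_div, one_div_one_div]
  push_cast
  ring

lemma lintegral_comp_negT_mul_le {N : ℕ} {q r : ℝ} (hq0 : 0 ≤ q) (hq1 : q ≤ 1)
    (hr0 : 0 ≤ r) (hr : r * (1 - discountDefect N q) ≤ 1) {φ : ℝ → ENNReal} (hφ : Measurable φ) :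
    ∫⁻ y in Set.Ico (0 : ℝ) 1, φ (negT y) * (stepWeight q r y * discountDensity q y)
      ≤ ∫⁻ y in Set.Ico (0 : ℝ) 1, φ y * discountDensity q y := by
  have hw := measurable_stepWeight q r
  have hg := measurable_discountDensity q
  calc _ ≤ ∑' k : ℕ, ∫⁻ x in Set.Ico (0 : ℝ) 1, ENNReal.ofReal (1 / (k + 2 - x) ^ 2) *
          (φ (negT (1 / (k + 2 - x))) * (stepWeight q r (1 / (k + 2 - x)) *
            discountDensity q (1 / (k + 2 - x)))) := lintegral_le_tsum_branch _
    _ = ∑' k : ℕ, ∫⁻ x in Set.Ico (0 : ℝ) 1, φ x * (ENNReal.ofReal (1 / (k + 2 - x) ^ 2) *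
          (stepWeight q r (1 / (k + 2 - x)) * discountDensity q (1 / (k + 2 - x)))) := by
        refine tsum_congr fun k => setLIntegral_congr_fun measurableSet_Ico fun x hx => ?_
        simp only [negT_branch k hx]
        ring
    _ = ∫⁻ x in Set.Ico (0 : ℝ) 1, φ x * ∑' k : ℕ, ENNReal.ofReal (1 / (k + 2 - x) ^ 2) *
          (stepWeight q r (1 / (k + 2 - x)) * discountDensity q (1 / (k + 2 - x))) := by
        rw [← lintegral_tsum fun k => by fun_prop]
        simp only [ENNReal.tsum_mul_left]
    _ ≤ _ := setLIntegral_mono' measurableSet_Ico fun x hx =>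
        mul_le_mul_right (tsum_branch_discountDensity_le hq0 hq1 hr0 hr hx) _

/-- The number of times `i < n` at which the orbit of `y` under `negT` lies below `1 / 2`. -/
noncomputable def lowVisits (n : ℕ) (y : ℝ) : ℕ :=
  ((Finset.range n).filter fun i => negT^[i] y < 1 / 2).card

lemma prod_stepWeight {q r : ℝ} (hq : 0 ≤ q) (hr : 0 ≤ r) (n : ℕ) (y : ℝ) :
    ∏ i ∈ Finset.range n, stepWeight q r (negT^[i] y)
      = ENNReal.ofReal (q ^ n * r ^ lowVisits n y) := by
  unfold stepWeight
  rw [← ENNReal.ofReal_prod_of_nonneg fun i _ => mul_nonneg hq (by split_ifs <;> positivity),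
    Finset.prod_mul_distrib, Finset.prod_const, Finset.card_range, Finset.prod_ite]
  simp [lowVisits]

lemma measurable_prod_stepWeight (q r : ℝ) (n : ℕ) :
    Measurable fun y => ∏ i ∈ Finset.range n, stepWeight q r (negT^[i] y) :=
  Finset.measurable_fun_prod _ fun i _ => (measurable_stepWeight q r).comp
    (measurable_negT.iterate i)

lemma lintegral_prod_stepWeight_le {N : ℕ} {q r : ℝ} (hq0 : 0 ≤ q) (hq1 : q ≤ 1)
    (hr0 : 0 ≤ r) (hr : r * (1 - discountDefect N q) ≤ 1) (n : ℕ) :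
    ∫⁻ y in Set.Ico (0 : ℝ) 1,
        (∏ i ∈ Finset.range n, stepWeight q r (negT^[i] y)) * discountDensity q y
      ≤ ∫⁻ y in Set.Ico (0 : ℝ) 1, discountDensity q y := by
  induction n with
  | zero => simp
  | succ n ih =>
    refine le_trans (le_of_eq ?_) ((lintegral_comp_negT_mul_le hq0 hq1 hr0 hr
      (measurable_prod_stepWeight q r n)).trans ih)
    refine lintegral_congr fun y => ?_
    simp only [Finset.prod_range_succ', Function.iterate_succ_apply, Function.iterate_zero, id,
      mul_assoc]

lemma ae_eventually_mul_lowVisits_lt {m : ℕ} (hm : m ≠ 0) :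
    ∀ᵐ y ∂(volume.restrict (Set.Ico (0 : ℝ) 1)), ∀ᶠ n in atTop, m * lowVisits n y < n := by
  obtain ⟨N, q, hq0, hq1, hD⟩ := exists_mul_lt_discountDefect m
  have hD1 : 0 < 1 - discountDefect N q := sub_pos.2 (discountDefect_lt_one N hq0.le hq1.le)
  set r : ℝ := (1 - discountDefect N q)⁻¹ with hr
  have hr0 : 0 < r := inv_pos.2 hD1
  have hqr : 1 < q ^ m * r := by
    rw [hr, ← div_eq_mul_inv, one_lt_div hD1]
    have := one_add_mul_sub_le_pow (by linarith : -1 ≤ q) m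
    linarith
  set β : ℝ := (q ^ m * r) ^ (1 / (m : ℝ)) with hβ
  have hβ1 : 1 < β := Real.one_lt_rpow hqr (by positivity)
  have hβ0 : 0 < β := zero_lt_one.trans hβ1
  have hβm : β ^ m = q ^ m * r := by
    rw [hβ, one_div, Real.rpow_inv_natCast_pow (by positivity) hm]
  set C : ENNReal := ∫⁻ y in Set.Ico (0 : ℝ) 1, discountDensity q y with hC
  have hCtop : C ≠ ⊤ := lintegral_discountDensity_ne_top hq0.le hq1
  set ν := volume.restrict (Set.Ico (0 : ℝ) 1) with hν
  have hbound : ∀ n : ℕ, ν {y | n ≤ m * lowVisits n y}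
      ≤ ENNReal.ofReal (β⁻¹ ^ n) * (ENNReal.ofReal 2 * C) := by
    intro n
    set Φ : ℝ → ENNReal := fun y => ∏ i ∈ Finset.range n, stepWeight q r (negT^[i] y) with hΦ
    have hsub : {y | n ≤ m * lowVisits n y} ⊆ {y | ENNReal.ofReal (β ^ n) ≤ Φ y} := by
      intro y hy
      have hy : n ≤ m * lowVisits n y := hy
      simp only [Set.mem_ofPred_eq, hΦ, prod_stepWeight hq0.le hr0.le]
      refine ENNReal.ofReal_le_ofReal ?_
      calc β ^ n ≤ β ^ (m * lowVisits n y) := pow_le_pow_right₀ hβ1.le hy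
        _ = q ^ (m * lowVisits n y) * r ^ lowVisits n y := by
          rw [pow_mul, hβm, mul_pow, pow_mul]
        _ ≤ q ^ n * r ^ lowVisits n y :=
          mul_le_mul_of_nonneg_right (pow_le_pow_of_le_one hq0.le hq1.le hy) (by positivity)
    have hΦint : ∫⁻ y, Φ y ∂ν ≤ ENNReal.ofReal 2 * C := by
      have h1 : ∫⁻ y, Φ y ∂ν ≤ ∫⁻ y, ENNReal.ofReal 2 * (Φ y * discountDensity q y) ∂ν := by
        refine setLIntegral_mono' measurableSet_Ico fun y hy => ?_
        calc Φ y = ENNReal.ofReal 2 * (Φ y * ENNReal.ofReal (1 / 2)) := by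
              rw [mul_left_comm, ← ENNReal.ofReal_mul (by norm_num)]
              norm_num
          _ ≤ _ := by gcongr; exact half_le_discountDensity q hy
      refine h1.trans ?_
      rw [lintegral_const_mul' _ _ ENNReal.ofReal_ne_top]
      gcongr
      exact lintegral_prod_stepWeight_le hq0.le hq1.le hr0.le
        (by rw [hr, inv_mul_cancel₀ hD1.ne']) n
    have hmarkov := mul_meas_ge_le_lintegral (μ := ν)
      (measurable_prod_stepWeight q r n) (ENNReal.ofReal (β ^ n))
    calc ν {y | n ≤ m * lowVisits n y} ≤ ν {y | ENNReal.ofReal (β ^ n) ≤ Φ y} :=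
          measure_mono hsub
      _ = ENNReal.ofReal (β⁻¹ ^ n) *
            (ENNReal.ofReal (β ^ n) * ν {y | ENNReal.ofReal (β ^ n) ≤ Φ y}) := by
          rw [← mul_assoc, ← ENNReal.ofReal_mul (by positivity), ← mul_pow,
            inv_mul_cancel₀ hβ0.ne']
          simp
      _ ≤ _ := mul_le_mul_right (hmarkov.trans hΦint) _
  have hsum : ∑' n : ℕ, ν {y | n ≤ m * lowVisits n y} ≠ ⊤ := by
    refine ne_top_of_le_ne_top ?_ (ENNReal.tsum_le_tsum hbound)
    rw [ENNReal.tsum_mul_right, ← ENNReal.ofReal_tsum_of_nonneg (fun n => by positivity)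
      (summable_geometric_of_lt_one (by positivity) (inv_lt_one_of_one_lt₀ hβ1))]
    exact ENNReal.mul_ne_top ENNReal.ofReal_ne_top (ENNReal.mul_ne_top ENNReal.ofReal_ne_top hCtop)
  filter_upwards [ae_eventually_notMem hsum] with y hy
  filter_upwards [hy] with n hn
  exact not_le.1 hn

lemma negT_iterate_mem_Ico {y : ℝ} (hy : y ∈ Set.Ico (0 : ℝ) 1) (n : ℕ) :
    negT^[n] y ∈ Set.Ico (0 : ℝ) 1 := by
  cases n with
  | zero => exact hy
  | succ n =>
    rw [Function.iterate_succ_apply']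
    exact ⟨Int.fract_nonneg _, Int.fract_lt_one _⟩

lemma negDigit_succ_eq_two {x : ℝ} (hx : 1 - x ∈ Set.Ico (0 : ℝ) 1) {i : ℕ}
    (hi : 1 / 2 ≤ negT^[i] (1 - x)) : negDigit x (i + 1) = 2 := by
  have hlt := (negT_iterate_mem_Ico hx i).2
  rw [negDigit, Nat.add_sub_cancel]
  have hceil : ⌈1 / negT^[i] (1 - x)⌉ = 2 := by
    rw [Int.ceil_eq_iff]
    constructor
    · have := (one_lt_div (by linarith)).2 hlt
      push_cast
      linarith
    · rw [div_le_iff₀ (by linarith)]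
      push_cast
      linarith
  rw [hceil]
  rfl

lemma le_card_negDigit_eq_two_add_lowVisits {x : ℝ} (hx : 1 - x ∈ Set.Ico (0 : ℝ) 1) (n : ℕ) :
    n ≤ ((Finset.Icc 1 n).filter fun i => negDigit x i = 2).card + lowVisits n (1 - x) := by
  have hsplit := Finset.card_filter_add_card_filter_not (s := Finset.range n)
    fun i => negT^[i] (1 - x) < 1 / 2
  rw [Finset.card_range] at hsplit
  have hinj : ((Finset.range n).filter fun i => ¬ negT^[i] (1 - x) < 1 / 2).card
      ≤ ((Finset.Icc 1 n).filter fun i => negDigit x i = 2).card := by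
    refine Finset.card_le_card_of_injOn (· + 1) (fun i hi => ?_)
      (add_left_injective 1).injOn
    simp only [Finset.coe_filter, Finset.mem_range, Set.mem_ofPred_eq, not_lt] at hi
    simp only [Finset.coe_filter, Finset.mem_Icc, Set.mem_ofPred_eq]
    exact ⟨⟨by omega, by omega⟩, negDigit_succ_eq_two hx hi.2⟩
  unfold lowVisits
  omega

lemma tendsto_card_negDigit_eq_two_div {x : ℝ} (hx : 1 - x ∈ Set.Ico (0 : ℝ) 1)
    (h : ∀ m : ℕ, m ≠ 0 → ∀ᶠ n in atTop, m * lowVisits n (1 - x) < n) :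
    Tendsto (fun n : ℕ => (((Finset.Icc 1 n).filter fun i => negDigit x i = 2).card : ℝ) / n)
      atTop (nhds 1) := by
  rw [Metric.tendsto_atTop']
  intro ε hε
  obtain ⟨m, hm⟩ := exists_nat_one_div_lt hε
  obtain ⟨n₀, hn₀⟩ := eventually_atTop.1 (h (m + 1) m.succ_ne_zero)
  refine ⟨n₀, fun n hn => ?_⟩
  have hlow := hn₀ n hn.le
  have hn0 : (0 : ℝ) < n := by exact_mod_cast hn.pos
  have hge := le_card_negDigit_eq_two_add_lowVisits hx n
  have hle : ((Finset.Icc 1 n).filter fun i => negDigit x i = 2).card ≤ n := by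
    simpa using Finset.card_filter_le (Finset.Icc 1 n) fun i => negDigit x i = 2
  generalize ((Finset.Icc 1 n).filter fun i => negDigit x i = 2).card = c at hge hle ⊢
  have hge' : (n : ℝ) ≤ c + lowVisits n (1 - x) := by exact_mod_cast hge
  have hle' : (c : ℝ) ≤ n := by exact_mod_cast hle
  have hlow' : ((m : ℝ) + 1) * lowVisits n (1 - x) < n := by exact_mod_cast hlow
  have hratio : (c : ℝ) / n ≤ 1 := (div_le_one hn0).2 hle'
  rw [Real.dist_eq, abs_sub_comm, abs_of_nonneg (by linarith)]
  refine lt_trans ?_ hm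
  rw [one_sub_div hn0.ne', div_lt_div_iff₀ hn0 (by positivity)]
  nlinarith [mul_le_mul_of_nonneg_left (sub_le_iff_le_add'.2 hge') (by positivity : 0 ≤ (m : ℝ) + 1)]

/-- For a.e. irrational `x ∈ (0,1)`, the frequency of the digit `2` in the
negative continued fraction expansion is `1`. -/
theorem negDigit_freq_two_eq_one :
    ∀ᵐ x ∂(volume.restrict (Set.Ioo (0 : ℝ) 1)), Irrational x →
      Tendsto
        (fun n : ℕ =>
          (((Finset.Icc 1 n).filter fun i => negDigit x i = 2).card : ℝ) / n)
        atTop (nhds 1) := by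
  have hlow : ∀ᵐ y ∂(volume : Measure ℝ), y ∈ Set.Ico (0 : ℝ) 1 →
      ∀ m : ℕ, m ≠ 0 → ∀ᶠ n in atTop, m * lowVisits n y < n :=
    (ae_restrict_iff' measurableSet_Ico).1
      (ae_all_iff.2 fun m => eventually_imp_distrib_left.2 ae_eventually_mul_lowVisits_lt)
  rw [ae_restrict_iff' measurableSet_Ioo]
  filter_upwards [(Measure.measurePreserving_sub_left volume (1 : ℝ)).quasiMeasurePreserving.ae
    hlow] with x hx hx01 _
  have hmem : 1 - x ∈ Set.Ico (0 : ℝ) 1 := ⟨by linarith [hx01.2], by linarith [hx01.1]⟩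
  exact tendsto_card_negDigit_eq_two_div hmem (hx hmem)
end

section
/- For Lebesgue-almost every irrational x ∈ (0,1), with P_n/Q_n the negative continued fraction convergents of x, one has lim_{n→∞} (1/n) log Q_n(x) = 0 and lim_{n→∞} (1/n) log |x − P_n(x)/Q_n(x)| = 0. -/
open MeasureTheory Filter Real

/-- Numerators of negative continued fraction convergents, shifted so that
`negP x (n+1) = P_n` with `P_{-1} = negP x 0 = 1`, `P_0 = negP x 1 = 1`,
`P_n = a'_n P_{n-1} - P_{n-2}`. -/
noncomputable def negP (x : ℝ) : ℕ → ℤ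
  | 0 => 1
  | 1 => 1
  | n + 2 => negDigit x (n + 1) * negP x (n + 1) - negP x n

/-- Denominators of negative continued fraction convergents, shifted so that
`negQ x (n+1) = Q_n` with `Q_{-1} = negQ x 0 = 0`, `Q_0 = negQ x 1 = 1`,
`Q_n = a'_n Q_{n-1} - Q_{n-2}`. -/
noncomputable def negQ (x : ℝ) : ℕ → ℤ
  | 0 => 0
  | 1 => 1
  | n + 2 => negDigit x (n + 1) * negQ x (n + 1) - negQ x n

/-- The density used to bound the weighted transfer operator of the map `u ↦ 1 - negT (1 - u)`. -/
noncomputable def excessiveDensity (t ε u : ℝ) : ℝ := 1 / (u + t * u ^ ε)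

/-- The inverse branches of the map `u ↦ 1 - negT (1 - u)`. -/
noncomputable def inverseBranch (j : ℕ) (u : ℝ) : ℝ := 1 - 1 / (j + 1 + u)

lemma rpow_le_one_add_mul_sqrt {x s : ℝ} (hx : 1 ≤ x) (hs : 0 ≤ s) (hs1 : s ≤ 1 / 2) :
    x ^ s ≤ 1 + 2 * s * √x := by
  have h1 : 1 ≤ √x := by rw [Real.one_le_sqrt]; exact hx
  have h := rpow_one_add_le_one_add_mul_self (s := √x - 1) (p := 2 * s)
    (by linarith) (by linarith) (by linarith)
  have h2 : (1 + (√x - 1)) ^ (2 * s) = x ^ s := by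
    rw [add_sub_cancel, Real.sqrt_eq_rpow, ← Real.rpow_mul (by linarith)]
    congr 1
    ring
  rw [h2] at h
  nlinarith

lemma one_div_mul_sqrt_le {m : ℝ} (hm : 1 ≤ m) :
    1 / (m * √(m + 1)) ≤ 3 * (1 / √m - 1 / √(m + 1)) := by
  have hp : 0 < √m := Real.sqrt_pos.mpr (by linarith)
  have hq : 0 < √(m + 1) := Real.sqrt_pos.mpr (by linarith)
  have hp2 : √m ^ 2 = m := Real.sq_sqrt (by linarith)
  have hq2 : √(m + 1) ^ 2 = m + 1 := Real.sq_sqrt (by linarith)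
  set p := √m
  set q := √(m + 1)
  have hq3 : q ≤ 3 / 2 * p := by
    refine abs_le_of_sq_le_sq' ?_ (by positivity) |>.2
    nlinarith
  rw [← hp2]
  have h1 : (q - p) * (q + p) = 1 := by nlinarith
  have h2 : 0 < q - p := by
    by_contra hcon
    nlinarith
  rw [div_sub_div _ _ hp.ne' hq.ne', ← mul_div_assoc, div_le_div_iff₀ (by positivity) (by positivity)]
  have h3 : p ≤ 3 * (q - p) * p ^ 2 := by
    have : 1 ≤ (q - p) * (3 * p) := by nlinarith
    nlinarith
  nlinarith

lemma sum_tail_branches_le {u s : ℝ} (hu : 0 < u) (hs : 0 ≤ s) (hs1 : s ≤ 1 / 2) (N : ℕ) :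
    ∑ j ∈ Finset.range N, ((j : ℝ) + 2 + u) ^ s / ((j + 2 + u) * (j + 1 + u)) ≤
      1 / (1 + u) + 6 * s := by
  have key : ∀ j : ℕ, ((j : ℝ) + 2 + u) ^ s / ((j + 2 + u) * (j + 1 + u)) ≤
      (1 / ((j : ℝ) + 1 + u) + 6 * s * (1 / √(j + 1 + u))) -
      (1 / (((j + 1 : ℕ) : ℝ) + 1 + u) + 6 * s * (1 / √((j + 1 : ℕ) + 1 + u))) := by
    intro j
    have hj : (0 : ℝ) ≤ j := j.cast_nonneg
    have h1 := rpow_le_one_add_mul_sqrt (x := j + 2 + u) (s := s) (by linarith) hs hs1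
    have h2 := one_div_mul_sqrt_le (m := j + 1 + u) (by linarith)
    have e : (j : ℝ) + 1 + u + 1 = j + 2 + u := by ring
    rw [e] at h2
    have e2 : (((j + 1 : ℕ) : ℝ) + 1 + u) = j + 2 + u := by push_cast; ring
    rw [e2]
    have hq : 0 < √((j : ℝ) + 2 + u) := Real.sqrt_pos.mpr (by linarith)
    have hq2 : √((j : ℝ) + 2 + u) ^ 2 = j + 2 + u := Real.sq_sqrt (by linarith)
    calc ((j : ℝ) + 2 + u) ^ s / ((j + 2 + u) * (j + 1 + u))
        ≤ (1 + 2 * s * √(j + 2 + u)) / ((j + 2 + u) * (j + 1 + u)) := by gcongr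
      _ = (1 / ((j : ℝ) + 1 + u) - 1 / (j + 2 + u))
            + 2 * s * (1 / ((j + 1 + u) * √(j + 2 + u))) := by
          have : (0 : ℝ) < j + 1 + u := by linarith
          have : (0 : ℝ) < j + 2 + u := by linarith
          rw [add_div]
          congr 1
          · field_simp
            ring
          · field_simp
            rw [hq2]
      _ ≤ _ := by
          have := mul_le_mul_of_nonneg_left h2 (by linarith : 0 ≤ 2 * s)
          linarith
  refine (Finset.sum_le_sum fun j _ => key j).trans ?_
  rw [Finset.sum_range_sub' (fun j : ℕ => 1 / ((j : ℝ) + 1 + u) + 6 * s * (1 / √(j + 1 + u)))]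
  have h1 : 1 / √((0 : ℕ) + 1 + u) ≤ 1 := by
    rw [div_le_one (Real.sqrt_pos.mpr (by push_cast; linarith)), Real.one_le_sqrt]
    push_cast
    linarith
  have h2 : 0 ≤ 1 / ((N : ℝ) + 1 + u) + 6 * s * (1 / √(N + 1 + u)) := by positivity
  have h3 : (((0 : ℕ) : ℝ) + 1 + u) = 1 + u := by push_cast; ring
  rw [h3] at h1 ⊢
  have := mul_le_mul_of_nonneg_left h1 (by linarith : 0 ≤ 6 * s)
  linarith

/-- The summand of the weighted transfer operator belonging to the branch `j`. -/
noncomputable def branchWeight (s t ε : ℝ) (j : ℕ) (u : ℝ) : ℝ :=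
  1 / (j + 1 + u) ^ 2 * (excessiveDensity t ε (inverseBranch j u) * (j + 1 + u) ^ s)

lemma excessiveDensity_nonneg {t ε u : ℝ} (ht : 0 ≤ t) (hu : 0 ≤ u) :
    0 ≤ excessiveDensity t ε u := by
  unfold excessiveDensity
  positivity

lemma branchWeight_succ_le {s t ε u : ℝ} (ht : 0 ≤ t) (hε1 : ε ≤ 1) (hu : 0 < u) (j : ℕ) :
    branchWeight s t ε (j + 1) u ≤
      1 / (1 + t) * (((j : ℝ) + 2 + u) ^ s / ((j + 2 + u) * (j + 1 + u))) := by
  have hj : (0 : ℝ) ≤ j := j.cast_nonneg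
  have e : (((j + 1 : ℕ) : ℝ) + 1 + u) = j + 2 + u := by push_cast; ring
  unfold branchWeight excessiveDensity inverseBranch
  rw [e]
  have e2 : 1 - 1 / ((j : ℝ) + 2 + u) = (j + 1 + u) / (j + 2 + u) := by
    field_simp
    ring
  rw [e2]
  have hw0 : 0 < ((j : ℝ) + 1 + u) / (j + 2 + u) := by positivity
  have hw1 : ((j : ℝ) + 1 + u) / (j + 2 + u) ≤ 1 := by
    rw [div_le_one (by positivity)]; linarith
  have h1 : ((j : ℝ) + 1 + u) / (j + 2 + u) ≤ (((j : ℝ) + 1 + u) / (j + 2 + u)) ^ ε := by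
    simpa using Real.rpow_le_rpow_of_exponent_ge hw0 hw1 hε1
  calc _ ≤ 1 / ((j : ℝ) + 2 + u) ^ 2 *
        (1 / (((j : ℝ) + 1 + u) / (j + 2 + u) + t * (((j : ℝ) + 1 + u) / (j + 2 + u))) *
          (j + 2 + u) ^ s) := by gcongr
    _ = _ := by field_simp

lemma branchWeight_zero_le {s t ε u : ℝ} (ht : 0 ≤ t) (hs : 0 ≤ s) (hs1 : s ≤ 1) (hu : 0 < u) :
    branchWeight s t ε 0 u ≤
      1 / ((1 + u) * (u + t * (u / (1 + u)) ^ ε * (1 + u))) + s := by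
  unfold branchWeight excessiveDensity inverseBranch
  have e : (((0 : ℕ) : ℝ) + 1 + u) = 1 + u := by push_cast; ring
  rw [e]
  have e2 : 1 - 1 / (1 + u) = u / (1 + u) := by
    field_simp
    ring
  rw [e2]
  have hB : 0 ≤ (u / (1 + u)) ^ ε := by positivity
  set B := (u / (1 + u)) ^ ε
  have h1 := rpow_one_add_le_one_add_mul_self (s := u) (p := s) (by linarith) hs hs1
  calc _ ≤ 1 / (1 + u) ^ 2 * (1 / (u / (1 + u) + t * B) * (1 + s * u)) := by gcongr
    _ = 1 / ((1 + u) * (u + t * B * (1 + u))) +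
          s * (u / ((1 + u) * (u + t * B * (1 + u)))) := by field_simp
    _ ≤ 1 / ((1 + u) * (u + t * B * (1 + u))) + s * 1 := by
        gcongr
        rw [div_le_one (by positivity)]
        have : 0 ≤ t * B * (1 + u) := by positivity
        nlinarith
    _ = _ := by ring

lemma excessive_inequality {δ s ε u : ℝ} (hδ : 0 < δ) (hε : ε = δ / 56) (hε1 : ε ≤ 1) (hs : 0 < s)
    (hsδ : 1568 * s ≤ δ * (δ / 28) ^ (1 / ε)) (hu : 0 < u) (hu1 : u < 1) :
    1 / ((1 + u) * (u + 28 * s * (u / (1 + u)) ^ ε * (1 + u))) + 1 / (1 + u) ≤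
      (1 + δ * s) * excessiveDensity (28 * s) ε u := by
  unfold excessiveDensity
  have hε0 : 0 < ε := by rw [hε]; positivity
  have hBA : u ^ ε ≤ (u / (1 + u)) ^ ε * (1 + ε * u) := by
    have h1 := rpow_one_add_le_one_add_mul_self (s := u) (p := ε) (by linarith) hε0.le hε1
    calc u ^ ε = (u / (1 + u)) ^ ε * (1 + u) ^ ε := by
          rw [← Real.mul_rpow (by positivity) (by positivity)]
          congr 1
          field_simp
      _ ≤ _ := by gcongr
  have hB0 : 0 < (u / (1 + u)) ^ ε := by positivity
  have hB1 : (u / (1 + u)) ^ ε ≤ 1 := by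
    apply Real.rpow_le_one (by positivity) _ hε0.le
    rw [div_le_one (by positivity)]
    linarith
  have hA0 : 0 < u ^ ε := by positivity
  have hA1 : u ^ ε ≤ 1 := Real.rpow_le_one hu.le hu1.le hε0.le
  have hcase : u ^ ε ≤ δ / 28 ∨ 1568 * s ≤ δ * u := by
    by_contra! hcon
    have h2 : (δ / 28) ^ (1 / ε) ≤ u := by
      calc (δ / 28) ^ (1 / ε) ≤ (u ^ ε) ^ (1 / ε) := by
            gcongr
            exact hcon.1.le
        _ = u := by
            rw [← Real.rpow_mul hu.le, mul_one_div_cancel hε0.ne', Real.rpow_one]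
    nlinarith
  set A := u ^ ε
  set B := (u / (1 + u)) ^ ε
  have key : (1 + 28 * s * B) * (u + 28 * s * A) ≤
      (1 + δ * s) * (u + 28 * s * B * (1 + u)) := by
    have h1 : 28 * s * (A - B) ≤ δ * s / 2 * u := by
      have h0 : A - B ≤ ε * u := by nlinarith [mul_pos hε0 hu]
      calc 28 * s * (A - B) ≤ 28 * s * (ε * u) := by gcongr
        _ = _ := by rw [hε]; ring
    have h2 : 28 * s * (28 * s * (A * B)) ≤ δ * s / 2 * u + δ * s * (28 * s * B) := by
      rcases hcase with h | h
      · have : 28 * s * (28 * s * (A * B)) ≤ 28 * s * (28 * s * (δ / 28 * B)) := by gcongr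
        have : 0 ≤ δ * s / 2 * u := by positivity
        linarith
      · have hAB : A * B ≤ 1 := by nlinarith
        have : 28 * s * (28 * s * (A * B)) ≤ 28 * s * (28 * s * 1) := by gcongr
        have : 0 ≤ δ * s * (28 * s * B) := by positivity
        nlinarith
    have h3 : 0 ≤ δ * s * (28 * s * B * u) := by positivity
    linarith
  calc _ = (1 + 28 * s * B) / (u + 28 * s * B * (1 + u)) := by
        field_simp
        ring
    _ ≤ (1 + δ * s) / (u + 28 * s * A) := by
        rw [div_le_div_iff₀ (by positivity) (by positivity)]
        exact key
    _ = _ := by ring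

lemma sum_branchWeight_le {δ s ε u : ℝ} (hδ : 0 < δ) (hε : ε = δ / 56) (hε1 : ε ≤ 1) (hs : 0 < s)
    (hs1 : 28 * s ≤ 1) (hsδ : 1568 * s ≤ δ * (δ / 28) ^ (1 / ε)) (hu : 0 < u) (hu1 : u < 1)
    (N : ℕ) :
    ∑ j ∈ Finset.range N, branchWeight s (28 * s) ε j u ≤
      (1 + δ * s) * excessiveDensity (28 * s) ε u := by
  rcases N with _ | N
  · simpa using mul_nonneg (by positivity)
      (excessiveDensity_nonneg (ε := ε) (by positivity : 0 ≤ 28 * s) hu.le)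
  rw [Finset.sum_range_succ']
  have h0 := branchWeight_zero_le (ε := ε) (by positivity : 0 ≤ 28 * s) hs.le (by linarith) hu
  have h1 : ∑ j ∈ Finset.range N, branchWeight s (28 * s) ε (j + 1) u ≤
      1 / (1 + 28 * s) * (1 / (1 + u) + 6 * s) := by
    refine (Finset.sum_le_sum fun j _ =>
      branchWeight_succ_le (by positivity) hε1 hu j).trans ?_
    rw [← Finset.mul_sum]
    gcongr
    exact sum_tail_branches_le hu hs.le (by linarith) N
  have h2 : 1 / (1 + 28 * s) * (1 / (1 + u) + 6 * s) ≤ 1 / (1 + u) - s := by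
    rw [one_div_mul_eq_div, div_le_iff₀ (by positivity)]
    have h3 : 1 / 2 ≤ 1 / (1 + u) := one_div_le_one_div_of_le (by linarith) (by linarith)
    nlinarith
  have h4 := excessive_inequality hδ hε hε1 hs hsδ hu hu1
  linarith

lemma Ioo_subset_iUnion_inverseBranch :
    Set.Ioo (0 : ℝ) 1 ⊆ ⋃ j : ℕ, inverseBranch j '' Set.Ico 0 1 := by
  intro x hx
  have hx1 : 0 < 1 - x := by linarith [hx.2]
  have h1 : 1 ≤ 1 / (1 - x) := by rw [le_div_iff₀ hx1]; linarith [hx.1]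
  obtain ⟨j, hj⟩ : ∃ j : ℕ, ⌊1 / (1 - x)⌋ = (j : ℤ) + 1 := by
    have : (1 : ℤ) ≤ ⌊1 / (1 - x)⌋ := Int.le_floor.mpr (by simpa using h1)
    exact ⟨(⌊1 / (1 - x)⌋ - 1).toNat, by omega⟩
  refine Set.mem_iUnion.mpr ⟨j, Int.fract (1 / (1 - x)),
    ⟨Int.fract_nonneg _, Int.fract_lt_one _⟩, ?_⟩
  have h2 : (j : ℝ) + 1 + Int.fract (1 / (1 - x)) = 1 / (1 - x) := by
    rw [Int.fract, hj]
    push_cast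
    ring
  rw [inverseBranch, h2, one_div_one_div]
  ring

lemma negT_one_sub_inverseBranch (j : ℕ) {u : ℝ} (hu : u ∈ Set.Ioo (0 : ℝ) 1) :
    1 - negT (1 - inverseBranch j u) = u := by
  have h : -1 / (1 / ((j : ℝ) + 1 + u)) = (1 - u) - ((j + 2 : ℕ) : ℝ) := by
    rw [div_div_eq_mul_div]
    push_cast
    ring
  rw [negT, inverseBranch, sub_sub_cancel, h, Int.fract_sub_natCast,
    Int.fract_eq_self.mpr ⟨by linarith [hu.2], by linarith [hu.1]⟩, sub_sub_cancel]

lemma lintegral_inverseBranch_image (j : ℕ) (F : ℝ → ENNReal) :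
    ∫⁻ x in inverseBranch j '' Set.Ico 0 1, F x =
      ∫⁻ u in Set.Ioo (0 : ℝ) 1, ENNReal.ofReal (1 / (j + 1 + u) ^ 2) * F (inverseBranch j u) := by
  have hpos : ∀ u ∈ Set.Ico (0 : ℝ) 1, (0 : ℝ) < j + 1 + u := fun u hu => by
    have := hu.1
    positivity
  rw [lintegral_image_eq_lintegral_abs_deriv_mul (f' := fun u => 1 / ((j : ℝ) + 1 + u) ^ 2)
    measurableSet_Ico]
  · rw [← Measure.restrict_congr_set Ioo_ae_eq_Ico]
    refine setLIntegral_congr_fun measurableSet_Ioo fun u hu => ?_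
    rw [abs_of_nonneg (by positivity)]
  · intro u hu
    have h := (((hasDerivAt_id u).const_add ((j : ℝ) + 1)).inv (hpos u hu).ne').const_sub 1
    refine (h.congr_deriv ?_).hasDerivWithinAt.congr_of_mem ?_ hu
    · simp [neg_div]
    · intro v _
      simp [inverseBranch]
  · intro u hu v hv huv
    simp only [inverseBranch, sub_right_inj, one_div, inv_inj] at huv
    linarith

lemma measurable_inverseBranch (j : ℕ) : Measurable (inverseBranch j) := by
  unfold inverseBranch
  fun_prop

lemma measurable_excessiveDensity (t ε : ℝ) : Measurable (excessiveDensity t ε) := by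
  unfold excessiveDensity
  fun_prop

lemma lintegral_transfer_le {δ s ε : ℝ} (hδ : 0 < δ) (hε : ε = δ / 56) (hε1 : ε ≤ 1) (hs : 0 < s)
    (hs1 : 28 * s ≤ 1) (hsδ : 1568 * s ≤ δ * (δ / 28) ^ (1 / ε)) {G : ℝ → ENNReal}
    (hG : Measurable G) :
    ∫⁻ x in Set.Ioo (0 : ℝ) 1, ENNReal.ofReal (excessiveDensity (28 * s) ε x) *
        (ENNReal.ofReal ((1 / (1 - x)) ^ s) * G (1 - negT (1 - x))) ≤
      ENNReal.ofReal (1 + δ * s) *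
        ∫⁻ x in Set.Ioo (0 : ℝ) 1, ENNReal.ofReal (excessiveDensity (28 * s) ε x) * G x := by
  have hmeas := measurable_excessiveDensity (28 * s) ε
  have hbranch : ∀ j : ℕ, ∀ u ∈ Set.Ioo (0 : ℝ) 1, 0 ≤ branchWeight s (28 * s) ε j u := by
    intro j u hu
    have hu0 := hu.1
    have : 0 ≤ inverseBranch j u := by
      rw [inverseBranch, sub_nonneg, div_le_one (by positivity)]
      have : (0 : ℝ) ≤ j := j.cast_nonneg
      linarith
    have := excessiveDensity_nonneg (ε := ε) (by positivity : 0 ≤ 28 * s) this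
    unfold branchWeight
    positivity
  calc _ ≤ ∫⁻ x in ⋃ j : ℕ, inverseBranch j '' Set.Ico 0 1,
        ENNReal.ofReal (excessiveDensity (28 * s) ε x) *
        (ENNReal.ofReal ((1 / (1 - x)) ^ s) * G (1 - negT (1 - x))) :=
        lintegral_mono_set Ioo_subset_iUnion_inverseBranch
    _ ≤ ∑' j : ℕ, ∫⁻ x in inverseBranch j '' Set.Ico 0 1,
        ENNReal.ofReal (excessiveDensity (28 * s) ε x) *
        (ENNReal.ofReal ((1 / (1 - x)) ^ s) * G (1 - negT (1 - x))) := lintegral_iUnion_le _ _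
    _ = ∑' j : ℕ, ∫⁻ u in Set.Ioo (0 : ℝ) 1,
        ENNReal.ofReal (branchWeight s (28 * s) ε j u) * G u := by
        refine tsum_congr fun j => ?_
        rw [lintegral_inverseBranch_image]
        refine setLIntegral_congr_fun measurableSet_Ioo fun u hu => ?_
        have hu0 := hu.1
        rw [negT_one_sub_inverseBranch j hu, branchWeight, ENNReal.ofReal_mul (by positivity),
          ENNReal.ofReal_mul' (by positivity)]
        have : 1 / (1 - inverseBranch j u) = j + 1 + u := by
          rw [inverseBranch, sub_sub_cancel, one_div_one_div]
        rw [this]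
        ring
    _ = ∫⁻ u in Set.Ioo (0 : ℝ) 1,
        ∑' j : ℕ, ENNReal.ofReal (branchWeight s (28 * s) ε j u) * G u := by
        rw [lintegral_tsum]
        intro j
        have h1 := measurable_inverseBranch j
        unfold branchWeight
        fun_prop
    _ ≤ ∫⁻ u in Set.Ioo (0 : ℝ) 1,
        ENNReal.ofReal (1 + δ * s) *
          (ENNReal.ofReal (excessiveDensity (28 * s) ε u) * G u) := by
        refine setLIntegral_mono' measurableSet_Ioo fun u hu => ?_
        rw [ENNReal.tsum_mul_right, ← mul_assoc, ← ENNReal.ofReal_mul (by positivity)]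
        gcongr
        refine ENNReal.tsum_le_of_sum_range_le fun N => ?_
        rw [← ENNReal.ofReal_sum_of_nonneg fun j _ => hbranch j u hu]
        exact ENNReal.ofReal_le_ofReal
          (sum_branchWeight_le hδ hε hε1 hs hs1 hsδ hu.1 hu.2 N)
    _ = _ := lintegral_const_mul _ (by fun_prop)

/-- The product of the reciprocals of the first `n` points of the `negT`-orbit of `1 - x`. -/
noncomputable def negTProd (x : ℝ) (n : ℕ) : ℝ := ∏ k ∈ Finset.range n, 1 / negT^[k] (1 - x)

lemma negTProd_succ' (x : ℝ) (n : ℕ) :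
    negTProd x (n + 1) = 1 / (1 - x) * negTProd (1 - negT (1 - x)) n := by
  rw [negTProd, Finset.prod_range_succ', mul_comm, negTProd, sub_sub_cancel]
  rfl

lemma measurable_negTProd (n : ℕ) : Measurable fun x => negTProd x n := by
  unfold negTProd
  have h : ∀ k, Measurable negT^[k] := fun k => measurable_negT.iterate k
  fun_prop

lemma negT_iterate_nonneg {y : ℝ} (hy : 0 ≤ y) (n : ℕ) : 0 ≤ negT^[n] y := by
  rcases n with _ | n
  · exact hy
  · rw [Function.iterate_succ_apply']
    exact Int.fract_nonneg _

lemma negTProd_nonneg {x : ℝ} (hx : x ≤ 1) (n : ℕ) : 0 ≤ negTProd x n :=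
  Finset.prod_nonneg fun k _ => one_div_nonneg.mpr (negT_iterate_nonneg (by linarith) k)

lemma lintegral_negTProd_rpow_le {δ s ε : ℝ} (hδ : 0 < δ) (hε : ε = δ / 56) (hε1 : ε ≤ 1)
    (hs : 0 < s) (hs1 : 28 * s ≤ 1) (hsδ : 1568 * s ≤ δ * (δ / 28) ^ (1 / ε)) (n : ℕ) :
    ∫⁻ x in Set.Ioo (0 : ℝ) 1, ENNReal.ofReal (excessiveDensity (28 * s) ε x) *
        ENNReal.ofReal (negTProd x n ^ s) ≤
      ENNReal.ofReal (1 + δ * s) ^ n *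
        ∫⁻ x in Set.Ioo (0 : ℝ) 1, ENNReal.ofReal (excessiveDensity (28 * s) ε x) := by
  induction n with
  | zero => simp [negTProd]
  | succ n ih =>
    have hm := measurable_negTProd n
    have h := lintegral_transfer_le hδ hε hε1 hs hs1 hsδ
      (G := fun x => ENNReal.ofReal (negTProd x n ^ s)) (by fun_prop)
    calc _ = _ := by
          refine setLIntegral_congr_fun measurableSet_Ioo fun x hx => ?_
          have hx1 : 0 < 1 - x := by linarith [hx.2]
          have h1 : 1 - negT (1 - x) ≤ 1 := by
            linarith [show 0 ≤ negT (1 - x) from Int.fract_nonneg _]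
          rw [negTProd_succ', Real.mul_rpow (by positivity) (negTProd_nonneg h1 n),
            ENNReal.ofReal_mul (by positivity)]
      _ ≤ _ := h
      _ ≤ _ := by
          rw [pow_succ', mul_assoc]
          gcongr

lemma lintegral_excessiveDensity_ne_top {t ε : ℝ} (ht : 0 < t) (hε1 : ε < 1) :
    ∫⁻ x in Set.Ioo (0 : ℝ) 1, ENNReal.ofReal (excessiveDensity t ε x) ≠ ⊤ := by
  have hintegrable : IntegrableOn (fun x : ℝ => 1 / t * x ^ (-ε)) (Set.Ioo 0 1) := by
    have := (intervalIntegral.intervalIntegrable_rpow' (a := 0) (b := 1) (r := -ε)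
      (by linarith)).1
    exact (this.mono_set Set.Ioo_subset_Ioc_self).const_mul _
  refine ne_top_of_le_ne_top hintegrable.lintegral_lt_top.ne ?_
  refine setLIntegral_mono' measurableSet_Ioo fun x hx => ENNReal.ofReal_le_ofReal ?_
  have hx0 := hx.1
  rw [Real.rpow_neg hx0.le, excessiveDensity, ← one_div, one_div_mul_one_div]
  gcongr
  linarith

lemma half_le_excessiveDensity {t ε x : ℝ} (ht : 0 < t) (ht1 : t ≤ 1) (hε : 0 ≤ ε)
    (hx : x ∈ Set.Ioo (0 : ℝ) 1) : 1 / 2 ≤ excessiveDensity t ε x := by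
  have hx0 := hx.1
  have h : x ^ ε ≤ 1 := Real.rpow_le_one hx.1.le hx.2.le hε
  have h0 : 0 ≤ x ^ ε := by positivity
  exact one_div_le_one_div_of_le (by positivity) (by nlinarith [hx.2])

lemma ae_negTProd_le {δ : ℝ} (hδ : 0 < δ) (hδ1 : δ ≤ 1) :
    ∀ᵐ x ∂(volume.restrict (Set.Ioo (0 : ℝ) 1)),
      ∃ C : ℝ, 0 < C ∧ ∀ n : ℕ, negTProd x n ≤ C * Real.exp (2 * δ * n) := by
  obtain ⟨ε, hε⟩ : ∃ ε, ε = δ / 56 := ⟨_, rfl⟩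
  have hε1 : ε < 1 := by linarith
  obtain ⟨s, hs, hs1, hsδ⟩ : ∃ s : ℝ, 0 < s ∧ 28 * s ≤ 1 ∧
      1568 * s ≤ δ * (δ / 28) ^ (1 / ε) := by
    have hb : 0 < δ * (δ / 28) ^ (1 / ε) := by positivity
    refine ⟨min (1 / 28) (δ * (δ / 28) ^ (1 / ε) / 1568), by positivity, ?_, ?_⟩
    · linarith [min_le_left (1 / 28) (δ * (δ / 28) ^ (1 / ε) / 1568)]
    · linarith [min_le_right (1 / 28) (δ * (δ / 28) ^ (1 / ε) / 1568)]
  let I := ∫⁻ x in Set.Ioo (0 : ℝ) 1, ENNReal.ofReal (excessiveDensity (28 * s) ε x)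
  have hI : I ≠ ⊤ := lintegral_excessiveDensity_ne_top (by positivity) hε1
  let r : ENNReal := ENNReal.ofReal (Real.exp (-(δ * s)))
  have hr : r < 1 := by
    rw [← ENNReal.ofReal_one]
    exact (ENNReal.ofReal_lt_ofReal_iff one_pos).mpr
      (by simpa using mul_pos hδ hs)
  let F : ℕ → ℝ → ENNReal := fun n x =>
    ENNReal.ofReal (1 / 2) * (ENNReal.ofReal (negTProd x n ^ s) *
      ENNReal.ofReal (Real.exp (-(2 * δ * s))) ^ n)
  have hFm : ∀ n, Measurable (F n) := fun n => by
    have hm := measurable_negTProd n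
    fun_prop
  have hF : ∀ n, ∫⁻ x in Set.Ioo (0 : ℝ) 1, F n x ≤ r ^ n * I := by
    intro n
    have hm := measurable_negTProd n
    have hm' := measurable_excessiveDensity (28 * s) ε
    calc ∫⁻ x in Set.Ioo (0 : ℝ) 1, F n x
        ≤ ∫⁻ x in Set.Ioo (0 : ℝ) 1, ENNReal.ofReal (Real.exp (-(2 * δ * s))) ^ n *
          (ENNReal.ofReal (excessiveDensity (28 * s) ε x) *
            ENNReal.ofReal (negTProd x n ^ s)) := by
          refine setLIntegral_mono' measurableSet_Ioo fun x hx => ?_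
          have h := ENNReal.ofReal_le_ofReal (half_le_excessiveDensity (ε := ε)
            (by positivity : 0 < 28 * s) hs1 (by rw [hε]; positivity) hx)
          calc F n x = ENNReal.ofReal (Real.exp (-(2 * δ * s))) ^ n *
                (ENNReal.ofReal (1 / 2) * ENNReal.ofReal (negTProd x n ^ s)) := by
                simp only [F]
                ring
            _ ≤ _ := by gcongr
      _ = ENNReal.ofReal (Real.exp (-(2 * δ * s))) ^ n *
          ∫⁻ x in Set.Ioo (0 : ℝ) 1, ENNReal.ofReal (excessiveDensity (28 * s) ε x) *
            ENNReal.ofReal (negTProd x n ^ s) := lintegral_const_mul _ (by fun_prop)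
      _ ≤ ENNReal.ofReal (Real.exp (-(2 * δ * s))) ^ n *
          (ENNReal.ofReal (1 + δ * s) ^ n * I) := by
          gcongr
          exact lintegral_negTProd_rpow_le hδ hε hε1.le hs hs1 hsδ n
      _ = (ENNReal.ofReal (Real.exp (-(2 * δ * s))) * ENNReal.ofReal (1 + δ * s)) ^ n * I := by
          rw [mul_pow, mul_assoc (_ ^ n)]
      _ ≤ r ^ n * I := by
          gcongr
          rw [← ENNReal.ofReal_mul (by positivity)]
          apply ENNReal.ofReal_le_ofReal
          calc Real.exp (-(2 * δ * s)) * (1 + δ * s)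
              ≤ Real.exp (-(2 * δ * s)) * Real.exp (δ * s) := by
                gcongr
                linarith [Real.add_one_le_exp (δ * s)]
            _ = Real.exp (-(δ * s)) := by
                rw [← Real.exp_add]
                congr 1
                ring
  have hsum : ∫⁻ x in Set.Ioo (0 : ℝ) 1, ∑' n, F n x ≠ ⊤ := by
    rw [lintegral_tsum fun n => (hFm n).aemeasurable]
    refine ne_top_of_le_ne_top ?_ (ENNReal.tsum_le_tsum hF)
    rw [ENNReal.tsum_mul_right, ENNReal.tsum_geometric]
    exact ENNReal.mul_ne_top (ENNReal.inv_ne_top.mpr (tsub_pos_of_lt hr).ne') hI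
  filter_upwards [ae_lt_top (Measurable.tsum hFm) hsum,
    ae_restrict_mem measurableSet_Ioo] with x hx hxI
  set M := (∑' n, F n x).toReal
  have hM : 0 ≤ M := ENNReal.toReal_nonneg
  refine ⟨(2 * M + 1) ^ (1 / s), by positivity, fun n => ?_⟩
  have hp := negTProd_nonneg hxI.2.le n
  have h1 : F n x = ENNReal.ofReal (1 / 2 * (negTProd x n ^ s * Real.exp (-(2 * δ * s)) ^ n)) := by
    rw [ENNReal.ofReal_mul (by positivity), ENNReal.ofReal_mul (by positivity),
      ENNReal.ofReal_pow (by positivity)]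
  have h2 : 1 / 2 * (negTProd x n ^ s * Real.exp (-(2 * δ * s)) ^ n) ≤ M := by
    rw [← ENNReal.ofReal_le_iff_le_toReal hx.ne, ← h1]
    exact ENNReal.le_tsum n
  have h3 : negTProd x n ^ s ≤ (2 * M + 1) * Real.exp (2 * δ * s * n) := by
    have e : Real.exp (-(2 * δ * s)) ^ n = (Real.exp (2 * δ * s * n))⁻¹ := by
      rw [← Real.exp_nat_mul, ← Real.exp_neg]
      congr 1
      ring
    rw [e, ← div_eq_mul_inv] at h2
    rw [← div_le_iff₀ (by positivity)]
    linarith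
  calc negTProd x n = (negTProd x n ^ s) ^ (1 / s) := by
        rw [← Real.rpow_mul hp, mul_one_div_cancel hs.ne', Real.rpow_one]
    _ ≤ ((2 * M + 1) * Real.exp (2 * δ * s * n)) ^ (1 / s) := by gcongr
    _ = _ := by
        rw [Real.mul_rpow (by positivity) (by positivity), ← Real.exp_mul]
        congr 2
        field_simp

lemma negT_mem_Ioo_of_irrational {y : ℝ} (hy : Irrational y) :
    negT y ∈ Set.Ioo (0 : ℝ) 1 ∧ Irrational (negT y) := by
  have h : Irrational (-1 / y) := by
    have := (irrational_inv_iff.mpr hy).neg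
    rwa [neg_div, one_div]
  have h2 : Irrational (negT y) := by
    rw [negT, Int.fract]
    exact h.sub_intCast _
  refine ⟨⟨lt_of_le_of_ne (Int.fract_nonneg _) fun h0 => ?_, Int.fract_lt_one _⟩, h2⟩
  exact h2.ne_zero h0.symm

lemma negT_iterate_mem_Ioo {x : ℝ} (hx : x ∈ Set.Ioo (0 : ℝ) 1) (hirr : Irrational x) (n : ℕ) :
    negT^[n] (1 - x) ∈ Set.Ioo (0 : ℝ) 1 ∧ Irrational (negT^[n] (1 - x)) := by
  induction n with
  | zero =>
    refine ⟨⟨by simpa using hx.2, by simpa using hx.1⟩, ?_⟩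
    simpa using hirr.intCast_sub 1
  | succ n ih =>
    rw [Function.iterate_succ_apply']
    exact negT_mem_Ioo_of_irrational ih.2

lemma negDigit_succ_eq {x : ℝ} (hx : x ∈ Set.Ioo (0 : ℝ) 1) (hirr : Irrational x) (n : ℕ) :
    (negDigit x (n + 1) : ℝ) = 1 / negT^[n] (1 - x) + negT^[n + 1] (1 - x) := by
  have hy := (negT_iterate_mem_Ioo hx hirr n).1
  rw [Function.iterate_succ_apply']
  rw [negDigit, Nat.add_sub_cancel]
  set y := negT^[n] (1 - x)
  have h1 : 0 ≤ ⌈1 / y⌉ := Int.ceil_nonneg (one_div_nonneg.mpr hy.1.le)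
  have h2 : ((⌈1 / y⌉.toNat : ℕ) : ℝ) = ((⌈1 / y⌉ : ℤ) : ℝ) := by
    exact_mod_cast congrArg (Int.cast : ℤ → ℝ) (Int.toNat_of_nonneg h1)
  rw [h2, negT, Int.fract, neg_div, Int.floor_neg]
  push_cast
  ring

lemma negTProd_succ (x : ℝ) (n : ℕ) :
    negTProd x (n + 1) = negTProd x n * (1 / negT^[n] (1 - x)) :=
  Finset.prod_range_succ _ _

lemma one_le_negTProd {x : ℝ} (hx : x ∈ Set.Ioo (0 : ℝ) 1) (hirr : Irrational x) (n : ℕ) :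
    1 ≤ negTProd x n := by
  induction n with
  | zero => simp [negTProd]
  | succ n ih =>
    have h := (negT_iterate_mem_Ioo hx hirr n).1
    rw [negTProd_succ]
    exact one_le_mul_of_one_le_of_one_le ih (by rw [le_div_iff₀ h.1]; linarith [h.2])

lemma negTProd_le_succ {x : ℝ} (hx : x ∈ Set.Ioo (0 : ℝ) 1) (hirr : Irrational x) (n : ℕ) :
    negTProd x n ≤ negTProd x (n + 1) := by
  have h := (negT_iterate_mem_Ioo hx hirr n).1
  rw [negTProd_succ]
  have h1 : 1 ≤ 1 / negT^[n] (1 - x) := by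
    rw [le_div_iff₀ h.1]
    linarith [h.2]
  nlinarith [one_le_negTProd hx hirr n]

lemma negQ_sub_negQ_mul {x : ℝ} (hx : x ∈ Set.Ioo (0 : ℝ) 1) (hirr : Irrational x) (n : ℕ) :
    (negQ x (n + 1) : ℝ) - negQ x n * negT^[n] (1 - x) = negTProd x n := by
  induction n with
  | zero => simp [negQ, negTProd]
  | succ n ih =>
    have hy := (negT_iterate_mem_Ioo hx hirr n).1.1
    rw [negTProd_succ, ← ih, negQ]
    push_cast
    rw [negDigit_succ_eq hx hirr]
    field_simp
    ring

lemma negP_sub_negP_mul {x : ℝ} (hx : x ∈ Set.Ioo (0 : ℝ) 1) (hirr : Irrational x) (n : ℕ) :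
    (negP x (n + 1) : ℝ) - negP x n * negT^[n] (1 - x) = x * negTProd x n := by
  induction n with
  | zero => simp [negP, negTProd]
  | succ n ih =>
    have hy := (negT_iterate_mem_Ioo hx hirr n).1.1
    rw [negTProd_succ, ← mul_assoc, ← ih, negP]
    push_cast
    rw [negDigit_succ_eq hx hirr]
    field_simp
    ring

lemma negP_mul_negQ_sub (x : ℝ) (n : ℕ) :
    negP x (n + 1) * negQ x n - negP x n * negQ x (n + 1) = -1 := by
  induction n with
  | zero => simp [negP, negQ]
  | succ n ih =>
    rw [negP, negQ]
    linarith

lemma two_le_negDigit_succ {x : ℝ} (hx : x ∈ Set.Ioo (0 : ℝ) 1) (hirr : Irrational x) (n : ℕ) :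
    2 ≤ negDigit x (n + 1) := by
  have h := (negT_iterate_mem_Ioo hx hirr n).1
  have h' := (negT_iterate_mem_Ioo hx hirr (n + 1)).1
  have h1 : 1 < 1 / negT^[n] (1 - x) := by
    rw [lt_div_iff₀ h.1]
    linarith [h.2]
  have h2 : (1 : ℝ) < negDigit x (n + 1) := by
    rw [negDigit_succ_eq hx hirr]
    linarith [h'.1]
  exact_mod_cast h2

lemma negQ_nonneg_and_lt_succ {x : ℝ} (hx : x ∈ Set.Ioo (0 : ℝ) 1) (hirr : Irrational x) (n : ℕ) :
    0 ≤ negQ x n ∧ negQ x n < negQ x (n + 1) := by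
  induction n with
  | zero => simp [negQ]
  | succ n ih =>
    have h : (2 : ℤ) ≤ negDigit x (n + 1) := by exact_mod_cast two_le_negDigit_succ hx hirr n
    refine ⟨by linarith, ?_⟩
    rw [negQ]
    nlinarith

lemma one_le_negQ_succ {x : ℝ} (hx : x ∈ Set.Ioo (0 : ℝ) 1) (hirr : Irrational x) (n : ℕ) :
    (1 : ℝ) ≤ negQ x (n + 1) := by
  have h := negQ_nonneg_and_lt_succ hx hirr n
  have : 1 ≤ negQ x (n + 1) := by linarith
  exact_mod_cast this

lemma negQ_succ_le {x : ℝ} (hx : x ∈ Set.Ioo (0 : ℝ) 1) (hirr : Irrational x) (n : ℕ) :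
    (negQ x (n + 1) : ℝ) ≤ (n + 1) * negTProd x n := by
  have hstep : ∀ k, (negQ x (k + 1) : ℝ) - negQ x k ≤ negTProd x k := by
    intro k
    rw [← negQ_sub_negQ_mul hx hirr]
    have h : (0 : ℝ) ≤ negQ x k := by exact_mod_cast (negQ_nonneg_and_lt_succ hx hirr k).1
    nlinarith [(negT_iterate_mem_Ioo hx hirr k).1.2]
  induction n with
  | zero => simp [negQ, negTProd]
  | succ n ih =>
    have h1 := hstep (n + 1)
    have h2 := negTProd_le_succ hx hirr n
    push_cast
    nlinarith

lemma abs_sub_convergent_eq {x : ℝ} (hx : x ∈ Set.Ioo (0 : ℝ) 1) (hirr : Irrational x) (n : ℕ) :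
    |x - (negP x (n + 1) : ℝ) / (negQ x (n + 1) : ℝ)| =
      (negTProd x (n + 1) * negQ x (n + 1))⁻¹ := by
  have hy := (negT_iterate_mem_Ioo hx hirr n).1.1
  have hq := one_le_negQ_succ hx hirr n
  have hT := one_le_negTProd hx hirr n
  have h1 := negQ_sub_negQ_mul hx hirr n
  have h2 := negP_sub_negP_mul hx hirr n
  have h3 : (negP x (n + 1) : ℝ) * negQ x n - negP x n * negQ x (n + 1) = -1 := by
    exact_mod_cast negP_mul_negQ_sub x n
  have h4 : x - (negP x (n + 1) : ℝ) / (negQ x (n + 1) : ℝ) =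
      -(negTProd x (n + 1) * negQ x (n + 1))⁻¹ := by
    have : (0 : ℝ) < negQ x (n + 1) := by linarith
    have : 0 < negTProd x n := by linarith
    rw [negTProd_succ]
    field_simp
    linear_combination (negQ x (n + 1) : ℝ) * (-h2) + negP x (n + 1) * h1 + negT^[n] (1 - x) * h3
  have : 0 < negTProd x (n + 1) * negQ x (n + 1) := by
    have := one_le_negTProd hx hirr (n + 1)
    positivity
  rw [h4, abs_neg, abs_of_pos (inv_pos.mpr this)]

lemma tendsto_log_negTProd_div {x : ℝ} (hx : x ∈ Set.Ioo (0 : ℝ) 1) (hirr : Irrational x)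
    (h : ∀ m : ℕ, ∃ C : ℝ, 0 < C ∧
      ∀ n : ℕ, negTProd x n ≤ C * Real.exp (2 * (1 / ((m : ℝ) + 1)) * n)) :
    Tendsto (fun n : ℕ => (1 / n : ℝ) * Real.log (negTProd x n)) atTop (nhds 0) := by
  have hnn : ∀ n : ℕ, 0 ≤ (1 / n : ℝ) * Real.log (negTProd x n) := fun n =>
    mul_nonneg (by positivity) (Real.log_nonneg (one_le_negTProd hx hirr n))
  rw [Metric.tendsto_atTop]
  intro η hη
  obtain ⟨m, hm⟩ := exists_nat_one_div_lt (by positivity : 0 < η / 4)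
  obtain ⟨C, hC, hbound⟩ := h m
  have hlim : ∀ᶠ n : ℕ in atTop, Real.log C / (n : ℝ) < η / 2 :=
    (tendsto_const_div_atTop_nhds_zero_nat (Real.log C)).eventually
      (gt_mem_nhds (by positivity))
  obtain ⟨N, hN⟩ := eventually_atTop.mp (hlim.and (eventually_gt_atTop 0))
  refine ⟨N, fun n hn => ?_⟩
  obtain ⟨h1, h2⟩ := hN n hn
  have hn0 : (0 : ℝ) < n := by exact_mod_cast h2
  rw [Real.dist_eq, sub_zero, abs_of_nonneg (hnn n)]
  have h3 := Real.log_le_log (by linarith [one_le_negTProd hx hirr n]) (hbound n)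
  rw [Real.log_mul hC.ne' (Real.exp_pos _).ne', Real.log_exp] at h3
  calc (1 / n : ℝ) * Real.log (negTProd x n)
      ≤ (1 / n : ℝ) * (Real.log C + 2 * (1 / ((m : ℝ) + 1)) * n) := by gcongr
    _ = Real.log C / n + 2 * (1 / ((m : ℝ) + 1)) := by field_simp
    _ < η := by linarith

lemma tendsto_log_natCast_add_one_div :
    Tendsto (fun n : ℕ => (1 / n : ℝ) * Real.log ((n : ℝ) + 1)) atTop (nhds 0) := by
  have h1 : Tendsto (fun n : ℕ => Real.log ((n + 1 : ℕ) : ℝ) / ((n + 1 : ℕ) : ℝ)) atTop (nhds 0) :=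
    (Real.isLittleO_log_id_atTop.tendsto_div_nhds_zero.comp
      tendsto_natCast_atTop_atTop).comp (tendsto_add_atTop_nat 1)
  have h2 : Tendsto (fun n : ℕ => 1 + 1 / (n : ℝ)) atTop (nhds (1 + 0)) :=
    tendsto_const_nhds.add tendsto_one_div_atTop_nhds_zero_nat
  have h3 := h1.mul h2
  rw [zero_mul] at h3
  refine h3.congr' ?_
  filter_upwards [eventually_gt_atTop 0] with n hn
  have : (0 : ℝ) < n := by exact_mod_cast hn
  push_cast
  field_simp

/-- For a.e. irrational `x ∈ (0,1)`: `(1/n) log Qₙ → 0` and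
`(1/n) log |x - Pₙ/Qₙ| → 0`.  (Recall `negP x (n+1) = Pₙ`, `negQ x (n+1) = Qₙ`.) -/
theorem negCF_log_denominator_ae :
    ∀ᵐ x ∂(volume.restrict (Set.Ioo (0 : ℝ) 1)), Irrational x →
      Tendsto (fun n : ℕ => (1 / n : ℝ) * Real.log (negQ x (n + 1))) atTop (nhds 0) ∧
      Tendsto (fun n : ℕ =>
          (1 / n : ℝ) * Real.log |x - (negP x (n + 1) : ℝ) / (negQ x (n + 1) : ℝ)|)
        atTop (nhds 0) := by
  have hae : ∀ᵐ x ∂(volume.restrict (Set.Ioo (0 : ℝ) 1)), ∀ m : ℕ, ∃ C : ℝ, 0 < C ∧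
      ∀ n : ℕ, negTProd x n ≤ C * Real.exp (2 * (1 / ((m : ℝ) + 1)) * n) := by
    rw [ae_all_iff]
    intro m
    refine ae_negTProd_le (by positivity) ?_
    rw [div_le_one (by positivity)]
    linarith [m.cast_nonneg (α := ℝ)]
  filter_upwards [hae, ae_restrict_mem measurableSet_Ioo] with x hbound hx hirr
  have hprod := tendsto_log_negTProd_div hx hirr hbound
  have hQ : Tendsto (fun n : ℕ => (1 / n : ℝ) * Real.log (negQ x (n + 1))) atTop (nhds 0) := by
    have hadd := tendsto_log_natCast_add_one_div.add hprod
    rw [add_zero] at hadd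
    refine squeeze_zero (fun n => ?_) (fun n => ?_) hadd
    · exact mul_nonneg (by positivity) (Real.log_nonneg (one_le_negQ_succ hx hirr n))
    · have hT := one_le_negTProd hx hirr n
      rw [← mul_add, ← Real.log_mul (by positivity) (by positivity)]
      have := Real.log_le_log (by linarith [one_le_negQ_succ hx hirr n]) (negQ_succ_le hx hirr n)
      exact mul_le_mul_of_nonneg_left this (by positivity)
  refine ⟨hQ, ?_⟩
  have hprod' : Tendsto (fun n : ℕ => (1 / n : ℝ) * Real.log (negTProd x (n + 1))) atTop
      (nhds 0) := by
    have h1 := hprod.comp (tendsto_add_atTop_nat 1)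
    have h2 : Tendsto (fun n : ℕ => 1 + 1 / (n : ℝ)) atTop (nhds (1 + 0)) :=
      tendsto_const_nhds.add tendsto_one_div_atTop_nhds_zero_nat
    have h3 := h1.mul h2
    rw [zero_mul] at h3
    refine h3.congr' ?_
    filter_upwards [eventually_gt_atTop 0] with n hn
    have : (0 : ℝ) < n := by exact_mod_cast hn
    simp only [Function.comp_apply]
    push_cast
    field_simp
  have hsum := (hprod'.add hQ).neg
  rw [add_zero, neg_zero] at hsum
  refine hsum.congr fun n => ?_
  have hT := one_le_negTProd hx hirr (n + 1)
  have hq := one_le_negQ_succ hx hirr n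
  rw [abs_sub_convergent_eq hx hirr, Real.log_inv, Real.log_mul (by positivity) (by positivity)]
  ring
end
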